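/- arXiv:1606.07763 — 7 statements merged into one kernel-verified Lean document; each statement's English description precedes it below -/
import Mathlib

section
/- Let ν>0, T>0, and let f:[0,T]×[0,π]→ℝ be continuous. Suppose u and u' are two classical solutions of the forced Burgers equation ∂_t w − ν ∂_x² w + w ∂_x w = f(t,x) on [0,T]×[0,π] with Dirichlet boundary conditions w(t,0)=w(t,π)=0. Then for every t∈[0,T], ∫₀^π |u(t,x) − u'(t,x)| dx ≤ ∫₀^π |u(0,x) − u'(0,x)| dx (contraction of the L¹-distance between solutions of the Burgers equation). -/
open Real Set MeasureTheory

/-- A classical solution of the forced Burgers equation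
`∂ₜ w − ν ∂ₓ² w + w ∂ₓ w = f(t,x)` on `[0,T] × [0,π]` with Dirichlet boundary
conditions. The functions `wt`, `wx`, `wxx` are the partial derivatives
`∂ₜ w`, `∂ₓ w`, `∂ₓ² w`, required to exist and be continuous on the closed
rectangle. -/
structure BurgersSolution (ν T : ℝ) (f : ℝ → ℝ → ℝ)
    (w wt wx wxx : ℝ → ℝ → ℝ) : Prop where
  cont : ContinuousOn (fun p : ℝ × ℝ => w p.1 p.2) (Icc 0 T ×ˢ Icc 0 π)
  cont_t : ContinuousOn (fun p : ℝ × ℝ => wt p.1 p.2) (Icc 0 T ×ˢ Icc 0 π)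
  cont_x : ContinuousOn (fun p : ℝ × ℝ => wx p.1 p.2) (Icc 0 T ×ˢ Icc 0 π)
  cont_xx : ContinuousOn (fun p : ℝ × ℝ => wxx p.1 p.2) (Icc 0 T ×ˢ Icc 0 π)
  hasDeriv_t : ∀ t ∈ Icc (0:ℝ) T, ∀ x ∈ Icc (0:ℝ) π,
    HasDerivWithinAt (fun τ => w τ x) (wt t x) (Icc 0 T) t
  hasDeriv_x : ∀ t ∈ Icc (0:ℝ) T, ∀ x ∈ Icc (0:ℝ) π,
    HasDerivWithinAt (fun y => w t y) (wx t x) (Icc 0 π) x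
  hasDeriv_xx : ∀ t ∈ Icc (0:ℝ) T, ∀ x ∈ Icc (0:ℝ) π,
    HasDerivWithinAt (fun y => wx t y) (wxx t x) (Icc 0 π) x
  eqn : ∀ t ∈ Ioo (0:ℝ) T, ∀ x ∈ Ioo (0:ℝ) π,
    wt t x - ν * wxx t x + w t x * wx t x = f t x
  bc0 : ∀ t ∈ Icc (0:ℝ) T, w t 0 = 0
  bcπ : ∀ t ∈ Icc (0:ℝ) T, w t π = 0

theorem sqrt_sq_add_sq_pos {δ : ℝ} (hδ : 0 < δ) (s : ℝ) : 0 < √(s ^ 2 + δ ^ 2) := by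
  positivity

theorem hasDerivAt_sqrt_sq_add_sq {δ : ℝ} (hδ : 0 < δ) (s : ℝ) :
    HasDerivAt (fun s => √(s ^ 2 + δ ^ 2)) (s / √(s ^ 2 + δ ^ 2)) s := by
  have h := ((hasDerivAt_pow 2 s).add_const (δ ^ 2)).sqrt (by positivity)
  convert h using 1
  norm_num
  field_simp

theorem hasDerivAt_div_sqrt_sq_add_sq {δ : ℝ} (hδ : 0 < δ) (s : ℝ) :
    HasDerivAt (fun s => s / √(s ^ 2 + δ ^ 2)) (δ ^ 2 / √(s ^ 2 + δ ^ 2) ^ 3) s := by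
  have hr := sqrt_sq_add_sq_pos hδ s
  have hsq : √(s ^ 2 + δ ^ 2) ^ 2 = s ^ 2 + δ ^ 2 := Real.sq_sqrt (by positivity)
  refine ((hasDerivAt_id' s).div (hasDerivAt_sqrt_sq_add_sq hδ s) hr.ne').congr_deriv ?_
  field_simp
  linarith

theorem continuous_div_sqrt_sq_add_sq {δ : ℝ} (hδ : 0 < δ) :
    Continuous (fun s => s / √(s ^ 2 + δ ^ 2)) :=
  continuous_iff_continuousAt.2 fun s => (hasDerivAt_div_sqrt_sq_add_sq hδ s).continuousAt

theorem continuous_sq_div_sqrt_sq_add_sq_pow {δ : ℝ} (hδ : 0 < δ) :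
    Continuous (fun s => δ ^ 2 / √(s ^ 2 + δ ^ 2) ^ 3) :=
  continuous_const.div (by fun_prop) fun s => (pow_pos (sqrt_sq_add_sq_pos hδ s) 3).ne'

/-- Completing the square: the dissipation absorbs the transport term up to `O(δ)`. -/
theorem transport_le_dissipation_add {δ ν B : ℝ} (hδ : 0 < δ) (hν : 0 < ν) {b : ℝ}
    (hb : |b| ≤ B) (s p : ℝ) :
    -(δ ^ 2 / √(s ^ 2 + δ ^ 2) ^ 3 * p * (ν * p - b * s)) ≤ B ^ 2 / (4 * ν) * δ := by
  have hr := sqrt_sq_add_sq_pos hδ s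
  have hsq : √(s ^ 2 + δ ^ 2) ^ 2 = s ^ 2 + δ ^ 2 := Real.sq_sqrt (by positivity)
  set r := √(s ^ 2 + δ ^ 2)
  have hδr : δ ≤ r := by nlinarith [sq_nonneg s]
  have hB : b ^ 2 ≤ B ^ 2 := sq_le_sq' (by linarith [abs_le.1 hb]) (abs_le.1 hb).2
  have hquad : -(p * (ν * p - b * s)) ≤ B ^ 2 / (4 * ν) * s ^ 2 := by
    have h1 : -(p * (ν * p - b * s)) ≤ b ^ 2 / (4 * ν) * s ^ 2 := by
      have h2 : b ^ 2 / (4 * ν) * s ^ 2 + p * (ν * p - b * s)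
          = (2 * ν * p - b * s) ^ 2 / (4 * ν) := by
        field_simp
        ring
      have h3 : 0 ≤ (2 * ν * p - b * s) ^ 2 / (4 * ν) := by positivity
      linarith
    refine h1.trans ?_
    gcongr
  have hmass : δ ^ 2 / r ^ 3 * s ^ 2 ≤ δ := by
    rw [div_mul_eq_mul_div, div_le_iff₀ (by positivity)]
    have h1 : s ^ 2 ≤ r ^ 2 := by nlinarith
    have h2 : δ * s ^ 2 ≤ r * r ^ 2 := by gcongr
    nlinarith
  calc -(δ ^ 2 / r ^ 3 * p * (ν * p - b * s))
      = δ ^ 2 / r ^ 3 * -(p * (ν * p - b * s)) := by ring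
    _ ≤ δ ^ 2 / r ^ 3 * (B ^ 2 / (4 * ν) * s ^ 2) := by gcongr
    _ = B ^ 2 / (4 * ν) * (δ ^ 2 / r ^ 3 * s ^ 2) := by ring
    _ ≤ B ^ 2 / (4 * ν) * δ := by gcongr

/-- Testing the divergence `∂ₓ(ν vₓ - b v)` against the regularised sign of `v`. -/
theorem integral_regularized_sign_mul_le {δ ν B l : ℝ} (hδ : 0 < δ) (hν : 0 < ν) (hl : 0 ≤ l)
    {v vx vxx b bx c : ℝ → ℝ}
    (hv : ∀ x ∈ Icc 0 l, HasDerivWithinAt v (vx x) (Icc 0 l) x)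
    (hvx : ∀ x ∈ Icc 0 l, HasDerivWithinAt vx (vxx x) (Icc 0 l) x)
    (hb : ∀ x ∈ Icc 0 l, HasDerivWithinAt b (bx x) (Icc 0 l) x)
    (hvxx_cont : ContinuousOn vxx (Icc 0 l)) (hbx_cont : ContinuousOn bx (Icc 0 l))
    (hc_cont : ContinuousOn c (Icc 0 l)) (hB : ∀ x ∈ Icc 0 l, |b x| ≤ B)
    (hc : ∀ x ∈ Ioo 0 l, c x = ν * vxx x - (bx x * v x + b x * vx x))
    (hv0 : v 0 = 0) (hvl : v l = 0) :
    ∫ x in (0:ℝ)..l, v x / √(v x ^ 2 + δ ^ 2) * c x ≤ l * (B ^ 2 / (4 * ν) * δ) := by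
  have cv : ContinuousOn v (Icc 0 l) := fun x hx => (hv x hx).continuousWithinAt
  have cvx : ContinuousOn vx (Icc 0 l) := fun x hx => (hvx x hx).continuousWithinAt
  have cb : ContinuousOn b (Icc 0 l) := fun x hx => (hb x hx).continuousWithinAt
  have cψ : ContinuousOn (fun x => v x / √(v x ^ 2 + δ ^ 2)) (Icc 0 l) :=
    (continuous_div_sqrt_sq_add_sq hδ).comp_continuousOn cv
  have cψ' : ContinuousOn (fun x => δ ^ 2 / √(v x ^ 2 + δ ^ 2) ^ 3) (Icc 0 l) :=
    (continuous_sq_div_sqrt_sq_add_sq_pow hδ).comp_continuousOn cv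
  let F : ℝ → ℝ := fun x => v x / √(v x ^ 2 + δ ^ 2) * (ν * vx x - b x * v x)
  let F' : ℝ → ℝ := fun x => δ ^ 2 / √(v x ^ 2 + δ ^ 2) ^ 3 * vx x * (ν * vx x - b x * v x)
    + v x / √(v x ^ 2 + δ ^ 2) * (ν * vxx x - (bx x * v x + b x * vx x))
  have cF : ContinuousOn F (Icc 0 l) := by
    exact cψ.mul ((continuousOn_const.mul cvx).sub (cb.mul cv))
  have cF' : ContinuousOn F' (Icc 0 l) := by
    exact ((cψ'.mul cvx).mul ((continuousOn_const.mul cvx).sub (cb.mul cv))).add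
      (cψ.mul ((continuousOn_const.mul hvxx_cont).sub ((hbx_cont.mul cv).add (cb.mul cvx))))
  have dF : ∀ x ∈ Ioo 0 l, HasDerivAt F (F' x) x := by
    intro x hx
    have hx' := Ioo_subset_Icc_self hx
    have hn := Icc_mem_nhds hx.1 hx.2
    have hvd := (hv x hx').hasDerivAt hn
    exact ((hasDerivAt_div_sqrt_sq_add_sq hδ (v x)).comp x hvd).mul
      ((((hvx x hx').hasDerivAt hn).const_mul ν).sub (((hb x hx').hasDerivAt hn).mul hvd))
  have iF' : IntervalIntegrable F' volume 0 l := cF'.intervalIntegrable_of_Icc hl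
  have hF : ∫ x in (0:ℝ)..l, F' x = 0 := by
    rw [intervalIntegral.integral_eq_sub_of_hasDerivAt_of_le hl cF dF iF']
    simp [F, hv0, hvl]
  calc ∫ x in (0:ℝ)..l, v x / √(v x ^ 2 + δ ^ 2) * c x
      ≤ ∫ x in (0:ℝ)..l, (F' x + B ^ 2 / (4 * ν) * δ) := by
        refine intervalIntegral.integral_mono_on_of_le_Ioo hl
          ((cψ.mul hc_cont).intervalIntegrable_of_Icc hl)
          (iF'.add intervalIntegrable_const) fun x hx => ?_
        have h := transport_le_dissipation_add hδ hν (hB x (Ioo_subset_Icc_self hx)) (v x) (vx x)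
        rw [hc x hx]
        simp only [F']
        linarith
    _ = l * (B ^ 2 / (4 * ν) * δ) := by
        rw [intervalIntegral.integral_add iF' intervalIntegrable_const, hF]
        rw [zero_add, intervalIntegral.integral_const, sub_zero, smul_eq_mul]

/-- Fundamental theorem of calculus in time, integrated in space and with the order of
integration exchanged. -/
theorem integral_sub_integral_eq_integral_integral {t l : ℝ} (ht : 0 ≤ t) (hl : 0 ≤ l)
    {g gt : ℝ → ℝ → ℝ}
    (hg : ContinuousOn (fun p : ℝ × ℝ => g p.1 p.2) (Icc 0 t ×ˢ Icc 0 l))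
    (hgt : ContinuousOn (fun p : ℝ × ℝ => gt p.1 p.2) (Icc 0 t ×ˢ Icc 0 l))
    (hd : ∀ τ ∈ Ioo 0 t, ∀ x ∈ Icc 0 l, HasDerivAt (fun τ => g τ x) (gt τ x) τ) :
    (∫ x in (0:ℝ)..l, g t x) - ∫ x in (0:ℝ)..l, g 0 x
      = ∫ τ in (0:ℝ)..t, ∫ x in (0:ℝ)..l, gt τ x := by
  have slice : ∀ τ ∈ Icc 0 t, ContinuousOn (g τ) (Icc 0 l) := fun τ hτ =>
    hg.comp (f := fun x => (τ, x)) (by fun_prop) fun x hx => ⟨hτ, hx⟩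
  have hint : IntegrableOn (Function.uncurry gt) (uIoc 0 t ×ˢ uIoc 0 l) := by
    rw [uIoc_of_le ht, uIoc_of_le hl]
    exact (hgt.integrableOn_compact (isCompact_Icc.prod isCompact_Icc)).mono_set
      (prod_mono Ioc_subset_Icc_self Ioc_subset_Icc_self)
  rw [MeasureTheory.intervalIntegral_intervalIntegral_swap hint,
    ← intervalIntegral.integral_sub
      ((slice t (right_mem_Icc.2 ht)).intervalIntegrable_of_Icc hl)
      ((slice 0 (left_mem_Icc.2 ht)).intervalIntegrable_of_Icc hl)]
  refine intervalIntegral.integral_congr fun x hx => ?_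
  rw [uIcc_of_le hl] at hx
  refine (intervalIntegral.integral_eq_sub_of_hasDerivAt_of_le ht
    (hg.comp (f := fun τ => (τ, x)) (by fun_prop) fun τ hτ => ⟨hτ, hx⟩)
    (fun τ hτ => hd τ hτ x hx) ?_).symm
  exact (hgt.comp (f := fun τ => (τ, x)) (by fun_prop)
    fun τ hτ => ⟨hτ, hx⟩).intervalIntegrable_of_Icc ht

/-- Contraction of the `L¹`-distance between two classical solutions of the
forced Burgers equation on `[0,T] × [0,π]` with Dirichlet boundary conditions. -/
theorem burgers_L1_contraction
    (ν T : ℝ) (hν : 0 < ν) (hT : 0 < T)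
    (f : ℝ → ℝ → ℝ)
    (hf : ContinuousOn (fun p : ℝ × ℝ => f p.1 p.2) (Icc 0 T ×ˢ Icc 0 π))
    (u ut ux uxx u' u't u'x u'xx : ℝ → ℝ → ℝ)
    (hu : BurgersSolution ν T f u ut ux uxx)
    (hu' : BurgersSolution ν T f u' u't u'x u'xx) :
    ∀ t ∈ Icc (0:ℝ) T,
      (∫ x in (0:ℝ)..π, |u t x - u' t x|) ≤ ∫ x in (0:ℝ)..π, |u 0 x - u' 0 x| := by
  intro t ht
  have hπ : (0:ℝ) ≤ π := pi_pos.le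
  obtain ⟨B, hB⟩ := (isCompact_Icc.prod isCompact_Icc).exists_bound_of_continuousOn
    ((hu.cont.add hu'.cont).div_const 2)
  have hsub : Icc 0 t ×ˢ Icc 0 π ⊆ Icc 0 T ×ˢ Icc 0 π :=
    prod_mono (Icc_subset_Icc_right ht.2) subset_rfl
  have cv := (hu.cont.sub hu'.cont).mono hsub
  have cvt := (hu.cont_t.sub hu'.cont_t).mono hsub
  have slice : ∀ {w : ℝ → ℝ → ℝ},
      ContinuousOn (fun p : ℝ × ℝ => w p.1 p.2) (Icc 0 T ×ˢ Icc 0 π) →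
      ∀ τ ∈ Icc 0 T, ContinuousOn (w τ) (Icc 0 π) := fun hw τ hτ =>
    hw.comp (f := fun x => (τ, x)) (by fun_prop) fun x hx => ⟨hτ, hx⟩
  have hφ : ∀ δ : ℝ, Continuous (fun s : ℝ => √(s ^ 2 + δ ^ 2)) := fun δ => by fun_prop
  have key : ∀ δ > 0, (∫ x in (0:ℝ)..π, |u t x - u' t x|)
      ≤ (∫ x in (0:ℝ)..π, |u 0 x - u' 0 x|) + δ * (π + t * (π * (B ^ 2 / (4 * ν)))) := by
    intro δ hδ
    have cg : ContinuousOn (fun p : ℝ × ℝ => √((u p.1 p.2 - u' p.1 p.2) ^ 2 + δ ^ 2))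
        (Icc 0 t ×ˢ Icc 0 π) := (hφ δ).comp_continuousOn cv
    have cgt : ContinuousOn (fun p : ℝ × ℝ =>
        (u p.1 p.2 - u' p.1 p.2) / √((u p.1 p.2 - u' p.1 p.2) ^ 2 + δ ^ 2)
          * (ut p.1 p.2 - u't p.1 p.2)) (Icc 0 t ×ˢ Icc 0 π) :=
      ((continuous_div_sqrt_sq_add_sq hδ).comp_continuousOn cv).mul cvt
    have hftc := integral_sub_integral_eq_integral_integral ht.1 hπ
      (g := fun τ x => √((u τ x - u' τ x) ^ 2 + δ ^ 2))
      (gt := fun τ x => (u τ x - u' τ x) / √((u τ x - u' τ x) ^ 2 + δ ^ 2)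
          * (ut τ x - u't τ x)) cg cgt (by
        intro τ hτ x hx
        have hτT : τ ∈ Icc 0 T := ⟨hτ.1.le, hτ.2.le.trans ht.2⟩
        have hn := Icc_mem_nhds hτ.1 (hτ.2.trans_le ht.2)
        exact (hasDerivAt_sqrt_sq_add_sq hδ (u τ x - u' τ x)).comp (h := fun τ => u τ x - u' τ x) τ
          (((hu.hasDeriv_t τ hτT x hx).hasDerivAt hn).sub
            ((hu'.hasDeriv_t τ hτT x hx).hasDerivAt hn)))
    have hslice : ∀ τ ∈ Ioo 0 t, ∫ x in (0:ℝ)..π,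
        (u τ x - u' τ x) / √((u τ x - u' τ x) ^ 2 + δ ^ 2) * (ut τ x - u't τ x)
          ≤ π * (B ^ 2 / (4 * ν) * δ) := by
      intro τ hτ
      have hτT : τ ∈ Icc 0 T := ⟨hτ.1.le, hτ.2.le.trans ht.2⟩
      refine integral_regularized_sign_mul_le hδ hν hπ
        (fun x hx => (hu.hasDeriv_x τ hτT x hx).sub (hu'.hasDeriv_x τ hτT x hx))
        (fun x hx => (hu.hasDeriv_xx τ hτT x hx).sub (hu'.hasDeriv_xx τ hτT x hx))
        (fun x hx => ((hu.hasDeriv_x τ hτT x hx).add (hu'.hasDeriv_x τ hτT x hx)).div_const 2)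
        ((slice hu.cont_xx τ hτT).sub (slice hu'.cont_xx τ hτT))
        (((slice hu.cont_x τ hτT).add (slice hu'.cont_x τ hτT)).div_const 2)
        ((slice hu.cont_t τ hτT).sub (slice hu'.cont_t τ hτT))
        (fun x hx => hB (τ, x) ⟨hτT, hx⟩) (fun x hx => ?_) ?_ ?_
      · have h1 := hu.eqn τ ⟨hτ.1, hτ.2.trans_le ht.2⟩ x hx
        have h2 := hu'.eqn τ ⟨hτ.1, hτ.2.trans_le ht.2⟩ x hx
        simp only [Pi.add_apply]
        linear_combination h1 - h2
      · simp [hu.bc0 τ hτT, hu'.bc0 τ hτT]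
      · simp [hu.bcπ τ hτT, hu'.bcπ τ hτT]
    have htime : (∫ τ in (0:ℝ)..t, ∫ x in (0:ℝ)..π,
        (u τ x - u' τ x) / √((u τ x - u' τ x) ^ 2 + δ ^ 2) * (ut τ x - u't τ x))
          ≤ t * (π * (B ^ 2 / (4 * ν) * δ)) := by
      have hint : Integrable (fun p : ℝ × ℝ =>
          (u p.1 p.2 - u' p.1 p.2) / √((u p.1 p.2 - u' p.1 p.2) ^ 2 + δ ^ 2)
            * (ut p.1 p.2 - u't p.1 p.2))
          ((volume.restrict (Ioc 0 t)).prod (volume.restrict (Ioc 0 π))) := by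
        rw [Measure.prod_restrict]
        exact (cgt.integrableOn_compact (isCompact_Icc.prod isCompact_Icc)).mono_set
          (prod_mono Ioc_subset_Icc_self Ioc_subset_Icc_self)
      refine (intervalIntegral.integral_mono_on_of_le_Ioo ht.1 ?_
        intervalIntegrable_const hslice).trans_eq (by
          rw [intervalIntegral.integral_const, sub_zero, smul_eq_mul])
      rw [intervalIntegrable_iff_integrableOn_Ioc_of_le ht.1]
      simp only [intervalIntegral.integral_of_le hπ]
      exact hint.integral_prod_left
    have cvs : ∀ τ ∈ Icc 0 T, ContinuousOn (fun x => u τ x - u' τ x) (Icc 0 π) :=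
      fun τ hτ => (slice hu.cont τ hτ).sub (slice hu'.cont τ hτ)
    have iφ : ∀ τ ∈ Icc 0 T, IntervalIntegrable
        (fun x => √((u τ x - u' τ x) ^ 2 + δ ^ 2)) volume 0 π := fun τ hτ =>
      ((hφ δ).comp_continuousOn (cvs τ hτ)).intervalIntegrable_of_Icc hπ
    have iabs : ∀ τ ∈ Icc 0 T, IntervalIntegrable
        (fun x => |u τ x - u' τ x|) volume 0 π := fun τ hτ =>
      (cvs τ hτ).abs.intervalIntegrable_of_Icc hπ
    have h0 : (0:ℝ) ∈ Icc 0 T := left_mem_Icc.2 hT.le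
    have hlow : (∫ x in (0:ℝ)..π, |u t x - u' t x|)
        ≤ ∫ x in (0:ℝ)..π, √((u t x - u' t x) ^ 2 + δ ^ 2) :=
      intervalIntegral.integral_mono_on hπ (iabs t ht) (iφ t ht) fun x _ =>
        Real.abs_le_sqrt (by linarith [sq_nonneg δ])
    have hup : (∫ x in (0:ℝ)..π, √((u 0 x - u' 0 x) ^ 2 + δ ^ 2))
        ≤ (∫ x in (0:ℝ)..π, |u 0 x - u' 0 x|) + π * δ := by
      calc (∫ x in (0:ℝ)..π, √((u 0 x - u' 0 x) ^ 2 + δ ^ 2))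
          ≤ ∫ x in (0:ℝ)..π, (|u 0 x - u' 0 x| + δ) := by
            refine intervalIntegral.integral_mono_on hπ (iφ 0 h0)
              ((iabs 0 h0).add intervalIntegrable_const) fun x _ => ?_
            refine Real.sqrt_le_iff.2 ⟨by positivity, ?_⟩
            nlinarith [sq_abs (u 0 x - u' 0 x), mul_nonneg (abs_nonneg (u 0 x - u' 0 x)) hδ.le]
        _ = _ := by
            rw [intervalIntegral.integral_add (iabs 0 h0) intervalIntegrable_const]
            simp
    linarith
  have hlim : Filter.Tendsto (fun δ : ℝ => (∫ x in (0:ℝ)..π, |u 0 x - u' 0 x|)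
      + δ * (π + t * (π * (B ^ 2 / (4 * ν))))) (nhdsWithin 0 (Ioi 0))
      (nhds (∫ x in (0:ℝ)..π, |u 0 x - u' 0 x|)) := by
    refine Filter.Tendsto.mono_left ?_ nhdsWithin_le_nhds
    exact Continuous.tendsto' (by fun_prop) _ _ (by simp)
  exact ge_of_tendsto hlim (eventually_mem_nhdsWithin.mono key)
end

section
/- Let ν>0 and let h:[0,π]→ℝ be continuous. There is a constant C₂>0, depending only on ν and sup_{x∈[0,π]}|h(x)|, with the following property. Let T>0, let z:[0,T]×[0,π]→ℝ be continuous together with its first spatial derivative ∂_x z, and set R_T = sup_{[0,T]×[0,π]} (|z(t,x)| + |∂_x z(t,x)|). Then every classical solution v of ∂_t v − ν ∂_x² v + (v+z) ∂_x (v+z) = h(x) on [0,T]×[0,π] with Dirichlet boundary conditions satisfies sup_{[0,T]×[0,π]} |v(t,x)| ≤ C₂ (R_T + 1) + sup_{x∈[0,π]} |v(0,x)|. -/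
open Real Set MeasureTheory

/-- A classical solution of the shifted Burgers equation
`∂ₜ v − ν ∂ₓ² v + (v+z) ∂ₓ (v+z) = h(x)` on `[0,T] × [0,π]` with Dirichlet
boundary conditions. The functions `vt`, `vx`, `vxx` are the partial
derivatives `∂ₜ v`, `∂ₓ v`, `∂ₓ² v`, required to exist and be continuous on
the closed rectangle, and `zx` is the spatial derivative `∂ₓ z`. -/
structure ShiftedBurgersSolution (ν T : ℝ) (h : ℝ → ℝ) (z zx : ℝ → ℝ → ℝ)
    (v vt vx vxx : ℝ → ℝ → ℝ) : Prop where
  cont : ContinuousOn (fun p : ℝ × ℝ => v p.1 p.2) (Icc 0 T ×ˢ Icc 0 π)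
  cont_t : ContinuousOn (fun p : ℝ × ℝ => vt p.1 p.2) (Icc 0 T ×ˢ Icc 0 π)
  cont_x : ContinuousOn (fun p : ℝ × ℝ => vx p.1 p.2) (Icc 0 T ×ˢ Icc 0 π)
  cont_xx : ContinuousOn (fun p : ℝ × ℝ => vxx p.1 p.2) (Icc 0 T ×ˢ Icc 0 π)
  hasDeriv_t : ∀ t ∈ Icc (0:ℝ) T, ∀ x ∈ Icc (0:ℝ) π,
    HasDerivWithinAt (fun τ => v τ x) (vt t x) (Icc 0 T) t
  hasDeriv_x : ∀ t ∈ Icc (0:ℝ) T, ∀ x ∈ Icc (0:ℝ) π,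
    HasDerivWithinAt (fun y => v t y) (vx t x) (Icc 0 π) x
  hasDeriv_xx : ∀ t ∈ Icc (0:ℝ) T, ∀ x ∈ Icc (0:ℝ) π,
    HasDerivWithinAt (fun y => vx t y) (vxx t x) (Icc 0 π) x
  eqn : ∀ t ∈ Ioo (0:ℝ) T, ∀ x ∈ Ioo (0:ℝ) π,
    vt t x - ν * vxx t x + (v t x + z t x) * (vx t x + zx t x) = h x
  bc0 : ∀ t ∈ Icc (0:ℝ) T, v t 0 = 0
  bcπ : ∀ t ∈ Icc (0:ℝ) T, v t π = 0

/-- A maximum principle on `[0,T] × [a,b]`: a function which is nonpositive on the parabolic boundary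
and has no positive interior point satisfying the first- and second-order conditions for a maximum is
nonpositive. -/
theorem nonpos_of_no_positive_parabolic_max {T a b : ℝ} {w wt wx wxx : ℝ → ℝ → ℝ}
    (hc : ContinuousOn (fun p : ℝ × ℝ => w p.1 p.2) (Icc 0 T ×ˢ Icc a b))
    (ht : ∀ t ∈ Icc (0:ℝ) T, ∀ x ∈ Icc a b,
      HasDerivWithinAt (fun τ => w τ x) (wt t x) (Icc 0 T) t)
    (hx : ∀ t ∈ Icc (0:ℝ) T, ∀ x ∈ Icc a b,
      HasDerivWithinAt (fun y => w t y) (wx t x) (Icc a b) x)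
    (hxx : ∀ t ∈ Icc (0:ℝ) T, ∀ x ∈ Icc a b,
      HasDerivWithinAt (fun y => wx t y) (wxx t x) (Icc a b) x)
    (hi : ∀ x ∈ Icc a b, w 0 x ≤ 0)
    (ha : ∀ t ∈ Icc (0:ℝ) T, w t a ≤ 0) (hb : ∀ t ∈ Icc (0:ℝ) T, w t b ≤ 0)
    (hno : ∀ t ∈ Ioc (0:ℝ) T, ∀ x ∈ Ioo a b,
      0 < w t x → 0 ≤ wt t x → wx t x = 0 → wxx t x ≤ 0 → False) :
    ∀ t ∈ Icc (0:ℝ) T, ∀ x ∈ Icc a b, w t x ≤ 0 := by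
  intro t htm x hxm
  obtain ⟨⟨s, y⟩, ⟨hs, hy⟩, hmax⟩ :=
    (isCompact_Icc.prod isCompact_Icc).exists_isMaxOn ⟨(t, x), ⟨htm, hxm⟩⟩ hc
  have hle : ∀ t ∈ Icc (0:ℝ) T, ∀ x ∈ Icc a b, w t x ≤ w s y := fun t ht x hx =>
    hmax (show (t, x) ∈ Icc (0:ℝ) T ×ˢ Icc a b from ⟨ht, hx⟩)
  refine (hle t htm x hxm).trans ?_
  by_contra! hpos
  simp only at hs hy
  have hs0 : 0 < s := hs.1.lt_of_ne (by rintro rfl; exact hpos.not_ge (hi y hy))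
  have hya : a < y := hy.1.lt_of_ne (by rintro rfl; exact hpos.not_ge (ha s hs))
  have hyb : y < b := hy.2.lt_of_ne (by rintro rfl; exact hpos.not_ge (hb s hs))
  have hloc : IsLocalMax (fun y => w s y) y := by
    filter_upwards [Icc_mem_nhds hya hyb] with r hr using hle s hs r hr
  have hwx : wx s y = 0 := hloc.hasDerivAt_eq_zero ((hx s hs y hy).hasDerivAt (Icc_mem_nhds hya hyb))
  refine hno s ⟨hs0, hs.2⟩ y ⟨hya, hyb⟩ hpos ?_ hwx ?_
  · have hmaxt : IsLocalMaxOn (fun τ => w τ y) (Icc 0 T) s :=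
      IsMaxOn.localize fun r hr => hle r hr y hy
    have hseg : segment ℝ s 0 ⊆ Icc (0:ℝ) T :=
      (convex_Icc 0 T).segment_subset hs ⟨le_rfl, hs.1.trans hs.2⟩
    have := hmaxt.hasFDerivWithinAt_nonpos (ht s hs y hy).hasFDerivWithinAt
      (sub_mem_posTangentConeAt_of_segment_subset hseg)
    simp at this
    nlinarith
  · by_contra! hwxx
    have hd : deriv (fun y => w s y) =ᶠ[nhds y] wx s := by
      filter_upwards [Ioo_mem_nhds hya hyb] with r hr
      exact ((hx s hs r ⟨hr.1.le, hr.2.le⟩).hasDerivAt (Icc_mem_nhds hr.1 hr.2)).deriv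
    have hdd : deriv (deriv fun y => w s y) y = wxx s y :=
      hd.deriv_eq.trans ((hxx s hs y hy).hasDerivAt (Icc_mem_nhds hya hyb)).deriv
    have hmin := isLocalMin_of_deriv_deriv_pos (f := fun y => w s y) (hdd ▸ hwxx)
      (hd.eq_of_nhds.trans hwx)
      ((hx s hs y hy).hasDerivAt (Icc_mem_nhds hya hyb)).continuousAt
    have hconst : (fun y => w s y) =ᶠ[nhds y] fun _ => w s y := by
      filter_upwards [hloc, hmin] with r h1 h2 using le_antisymm h1 h2
    have := hconst.deriv.deriv_eq
    rw [hdd] at this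
    simp at this
    exact hwxx.ne' this

/-- The shifted Burgers equation extends by continuity to the final time. -/
theorem ShiftedBurgersSolution.eqn_Ioc {ν T : ℝ} {h : ℝ → ℝ} {z zx v vt vx vxx : ℝ → ℝ → ℝ}
    (hv : ShiftedBurgersSolution ν T h z zx v vt vx vxx)
    (hz : ContinuousOn (fun p : ℝ × ℝ => z p.1 p.2) (Icc 0 T ×ˢ Icc 0 π))
    (hzx : ContinuousOn (fun p : ℝ × ℝ => zx p.1 p.2) (Icc 0 T ×ˢ Icc 0 π)) :
    ∀ t ∈ Ioc (0:ℝ) T, ∀ x ∈ Ioo (0:ℝ) π,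
      vt t x - ν * vxx t x + (v t x + z t x) * (vx t x + zx t x) = h x := by
  intro t ht x hx
  have slice {g : ℝ → ℝ → ℝ}
      (hg : ContinuousOn (fun p : ℝ × ℝ => g p.1 p.2) (Icc 0 T ×ˢ Icc 0 π)) :
      ContinuousOn (fun τ => g τ x) (Icc 0 T) :=
    hg.comp (f := fun τ => (τ, x)) (by fun_prop) fun τ hτ => ⟨hτ, hx.1.le, hx.2.le⟩
  have hcont : ContinuousOn
      (fun τ => vt τ x - ν * vxx τ x + (v τ x + z τ x) * (vx τ x + zx τ x)) (Icc 0 T) :=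
    ((slice hv.cont_t).sub (continuousOn_const.mul (slice hv.cont_xx))).add
      (((slice hv.cont).add (slice hz)).mul ((slice hv.cont_x).add (slice hzx)))
  have hEq : EqOn (fun τ => vt τ x - ν * vxx τ x + (v τ x + z τ x) * (vx τ x + zx τ x))
      (fun _ => h x) (Ioo 0 T) := fun τ hτ => hv.eqn τ hτ x hx
  exact hEq.of_subset_closure hcont continuousOn_const Ioo_subset_Icc_self
    (closure_Ioo (ht.1.trans_le ht.2).ne).ge ⟨ht.1.le, ht.2⟩

/-- Maximum-principle bound for solutions of the shifted Burgers equation: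
`sup |v| ≤ C₂ (R_T + 1) + sup |v(0,·)|`, where the constant `C₂ > 0` depends
only on `ν` and on (a bound `h₀` for) `sup |h|`, and `R_T` is any bound for
`sup (|z| + |∂ₓ z|)` over `[0,T] × [0,π]`. -/
theorem shifted_burgers_maximum_principle_bound
    (ν h₀ : ℝ) (hν : 0 < ν) (hh₀ : 0 ≤ h₀) :
    ∃ C₂ > (0:ℝ),
      ∀ (h : ℝ → ℝ), ContinuousOn h (Icc 0 π) →
        (∀ x ∈ Icc (0:ℝ) π, |h x| ≤ h₀) →
      ∀ (T : ℝ), 0 < T →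
      ∀ (z zx : ℝ → ℝ → ℝ),
        ContinuousOn (fun p : ℝ × ℝ => z p.1 p.2) (Icc 0 T ×ˢ Icc 0 π) →
        ContinuousOn (fun p : ℝ × ℝ => zx p.1 p.2) (Icc 0 T ×ˢ Icc 0 π) →
        (∀ t ∈ Icc (0:ℝ) T, ∀ x ∈ Icc (0:ℝ) π,
          HasDerivWithinAt (fun y => z t y) (zx t x) (Icc 0 π) x) →
      ∀ (R_T : ℝ),
        (∀ t ∈ Icc (0:ℝ) T, ∀ x ∈ Icc (0:ℝ) π, |z t x| + |zx t x| ≤ R_T) →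
      ∀ (v vt vx vxx : ℝ → ℝ → ℝ),
        ShiftedBurgersSolution ν T h z zx v vt vx vxx →
      ∀ (M₀ : ℝ), (∀ x ∈ Icc (0:ℝ) π, |v 0 x| ≤ M₀) →
      ∀ t ∈ Icc (0:ℝ) T, ∀ x ∈ Icc (0:ℝ) π,
        |v t x| ≤ C₂ * (R_T + 1) + M₀ := by
  refine ⟨π + 1 + h₀, by positivity, ?_⟩
  intro h _ hh T hT z zx hz hzx _ R hR v vt vx vxx hv M hM t ht x hx
  have hpi := pi_pos
  have hR0 : 0 ≤ R := (by positivity : 0 ≤ |z t x| + |zx t x|).trans (hR t ht x hx)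
  have hM0 : 0 ≤ M := (abs_nonneg _).trans (hM x hx)
  have heqn := hv.eqn_Ioc hz hzx
  have hlin (c y : ℝ) :
      HasDerivWithinAt (fun y => (R + 1) * y + c) (R + 1) (Icc 0 π) y := by
    simpa using (((hasDerivAt_id y).const_mul (R + 1)).add_const c).hasDerivWithinAt
  have hlinc (c : ℝ) : ContinuousOn (fun p : ℝ × ℝ => (R + 1) * p.2 + c)
      (Icc 0 T ×ˢ Icc 0 π) := by fun_prop
  have hzb : ∀ t ∈ Ioc (0:ℝ) T, ∀ x ∈ Ioo (0:ℝ) π,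
      |z t x| ≤ R ∧ -R ≤ zx t x := fun t ht x hx => by
    have := hR t ⟨ht.1.le, ht.2⟩ x ⟨hx.1.le, hx.2.le⟩
    have h1 := neg_abs_le (zx t x)
    exact ⟨by linarith [abs_nonneg (zx t x)], by linarith [abs_nonneg (z t x)]⟩
  have upper := nonpos_of_no_positive_parabolic_max
    (w := fun t x => v t x - ((R + 1) * x + (R + 1 + h₀ + M)))
    (wt := vt) (wx := fun t x => vx t x - (R + 1)) (wxx := vxx)
    (hv.cont.sub (hlinc _)) (fun t ht x hx => (hv.hasDeriv_t t ht x hx).sub_const _)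
    (fun t ht x hx => (hv.hasDeriv_x t ht x hx).sub (hlin _ x))
    (fun t ht x hx => (hv.hasDeriv_xx t ht x hx).sub_const _)
    (fun x hx => by
      have := (abs_le.1 (hM x hx)).2
      have := mul_nonneg (by linarith : 0 ≤ R + 1) hx.1
      linarith)
    (fun t ht => by
      simp only [hv.bc0 t ht]
      linarith)
    (fun t ht => by
      simp only [hv.bcπ t ht]
      nlinarith)
    (fun t ht x hx h1 h2 h3 h4 => by
      have he := heqn t ht x hx
      obtain ⟨hz1, hzx1⟩ := hzb t ht x hx
      have hz2 := (abs_le.1 hz1).1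
      have hh1 := (abs_le.1 (hh x ⟨hx.1.le, hx.2.le⟩)).2
      have := mul_nonneg (by linarith : 0 ≤ R + 1) hx.1.le
      have hu : h₀ + 1 < v t x + z t x := by linarith
      have hd : 1 ≤ vx t x + zx t x := by linarith
      have := mul_le_mul_of_nonneg_left hd (by linarith : 0 ≤ v t x + z t x)
      have := mul_nonneg hν.le (neg_nonneg.2 h4)
      linarith)
    t ht x hx
  have lower := nonpos_of_no_positive_parabolic_max
    (w := fun t x => ((R + 1) * x + (-((R + 1) * π) - (R + 1 + h₀ + M))) - v t x)
    (wt := fun t x => -vt t x) (wx := fun t x => (R + 1) - vx t x) (wxx := fun t x => -vxx t x)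
    ((hlinc _).sub hv.cont) (fun t ht x hx => (hv.hasDeriv_t t ht x hx).const_sub _)
    (fun t ht x hx => (hlin _ x).sub (hv.hasDeriv_x t ht x hx))
    (fun t ht x hx => (hv.hasDeriv_xx t ht x hx).const_sub _)
    (fun x hx => by
      have := (abs_le.1 (hM x hx)).1
      have := mul_nonneg (by linarith : 0 ≤ R + 1) (sub_nonneg.2 hx.2)
      linarith)
    (fun t ht => by
      simp only [hv.bc0 t ht]
      nlinarith)
    (fun t ht => by
      simp only [hv.bcπ t ht]
      linarith)
    (fun t ht x hx h1 h2 h3 h4 => by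
      have he := heqn t ht x hx
      obtain ⟨hz1, hzx1⟩ := hzb t ht x hx
      have hz2 := (abs_le.1 hz1).2
      have hh1 := (abs_le.1 (hh x ⟨hx.1.le, hx.2.le⟩)).1
      have := mul_nonneg (by linarith : 0 ≤ R + 1) (sub_nonneg.2 hx.2.le)
      have hu : v t x + z t x < -(h₀ + 1) := by linarith
      have hd : 1 ≤ vx t x + zx t x := by linarith
      have := mul_le_mul_of_nonneg_left hd (by linarith : 0 ≤ -(v t x + z t x))
      have := mul_nonneg hν.le (neg_nonpos.1 h4)
      linarith)
    t ht x hx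
  have h1 := mul_nonneg (by linarith : 0 ≤ R + 1) hx.1
  have h2 := mul_nonneg (by linarith : 0 ≤ R + 1) (sub_nonneg.2 hx.2)
  have h3 := mul_nonneg hh₀ hR0
  rw [abs_le]
  constructor <;> linarith
end

section
/- Let ν>0 and h₀>0. There exist ρ>0 and R₁>0, depending only on ν and h₀, with the following property: for every continuous function h:[0,π]→ℝ with sup_{x∈[0,π]}|h(x)| ≤ h₀, every function z:[0,1]×[0,π]→ℝ which is continuous together with its spatial derivative ∂_x z and satisfies sup_{[0,1]×[0,π]} (|z(t,x)| + |∂_x z(t,x)|) ≤ ρ, and every classical solution v of ∂_t v − ν ∂_x² v + (v+z) ∂_x (v+z) = h(x) on [0,1]×[0,π] with Dirichlet boundary conditions, one has sup_{x∈[0,π]} |v(1,x)| ≤ R₁. In particular the bound R₁ does not depend on the initial condition v(0,·). -/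
open Real Set MeasureTheory

open scoped Topology

/-- At an interior local maximum, the second derivative is nonpositive. -/
theorem IsLocalMax.second_deriv_nonpos {f f' : ℝ → ℝ} {a c : ℝ} (hmax : IsLocalMax f a)
    (hf : ∀ᶠ x in 𝓝 a, HasDerivAt f (f' x) x) (hf' : HasDerivAt f' c a) : c ≤ 0 := by
  by_contra! hc
  have hd : deriv f =ᶠ[𝓝 a] f' := hf.mono fun x hx => hx.deriv
  have hdd : deriv (deriv f) a = c := by rw [hd.deriv_eq, hf'.deriv]
  have hmin : IsLocalMin f a :=
    isLocalMin_of_deriv_deriv_pos (by rwa [hdd]) hmax.deriv_eq_zero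
      hf.self_of_nhds.continuousAt
  have hconst : f =ᶠ[𝓝 a] fun _ => f a := by
    filter_upwards [hmax, hmin] with x h₁ h₂ using le_antisymm h₁ h₂
  have hzero : deriv (deriv f) a = 0 := by
    rw [hconst.deriv.deriv_eq]
    simp
  linarith

/-- At a maximum over `[0, b]` attained at the right endpoint, the derivative is nonnegative. -/
theorem HasDerivWithinAt.nonneg_of_isMaxOn_Icc {f : ℝ → ℝ} {b c : ℝ} (hb : 0 < b)
    (hf : HasDerivWithinAt f c (Icc 0 b) b) (hmax : ∀ t ∈ Icc 0 b, f t ≤ f b) : 0 ≤ c := by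
  have hne : (𝓝[Icc 0 b \ {b}] b).NeBot := by
    rw [Icc_sdiff_right, nhdsWithin_Ico_eq_nhdsLT hb]
    infer_instance
  refine ge_of_tendsto (hasDerivWithinAt_iff_tendsto_slope.mp hf) ?_
  filter_upwards [self_mem_nhdsWithin] with t ht
  rw [slope_def_field]
  exact div_nonneg_of_nonpos (by linarith [hmax t ht.1]) (by linarith [ht.1.2])

namespace ShiftedBurgersSolution

variable {ν T : ℝ} {h : ℝ → ℝ} {z zx v vt vx vxx : ℝ → ℝ → ℝ}

/-- The equation is invariant under `v(t,x) ↦ -v(t,π-x)`. -/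
theorem reflect (hv : ShiftedBurgersSolution ν T h z zx v vt vx vxx) :
    ShiftedBurgersSolution ν T (fun x => -h (π - x))
      (fun t x => -z t (π - x)) (fun t x => zx t (π - x))
      (fun t x => -v t (π - x)) (fun t x => -vt t (π - x))
      (fun t x => vx t (π - x)) (fun t x => -vxx t (π - x)) := by
  have hmem : ∀ x ∈ Icc (0:ℝ) π, π - x ∈ Icc (0:ℝ) π := fun x hx =>
    ⟨by linarith [hx.2], by linarith [hx.1]⟩
  have hr : ContinuousOn (fun p : ℝ × ℝ => (p.1, π - p.2)) (Icc 0 T ×ˢ Icc 0 π) := by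
    fun_prop
  have hmaps : MapsTo (fun p : ℝ × ℝ => (p.1, π - p.2)) (Icc 0 T ×ˢ Icc 0 π)
      (Icc 0 T ×ˢ Icc 0 π) := fun p hp => ⟨hp.1, hmem _ hp.2⟩
  have hrefl : ∀ x, HasDerivWithinAt (fun y : ℝ => π - y) (-1) (Icc 0 π) x := fun x =>
    ((hasDerivAt_id x).const_sub π).hasDerivWithinAt
  exact
    { cont := (hv.cont.comp hr hmaps).neg
      cont_t := (hv.cont_t.comp hr hmaps).neg
      cont_x := hv.cont_x.comp hr hmaps
      cont_xx := (hv.cont_xx.comp hr hmaps).neg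
      hasDeriv_t := fun t ht x hx => (hv.hasDeriv_t t ht _ (hmem x hx)).neg
      hasDeriv_x := fun t ht x hx => by
        have := ((hv.hasDeriv_x t ht _ (hmem x hx)).comp x (hrefl x) hmem).neg
        rw [mul_neg_one, neg_neg] at this
        exact this
      hasDeriv_xx := fun t ht x hx => by
        have := (hv.hasDeriv_xx t ht _ (hmem x hx)).comp x (hrefl x) hmem
        simpa [Function.comp_def] using this
      eqn := fun t ht x hx => by
        have := hv.eqn t ht (π - x) ⟨by linarith [hx.2], by linarith [hx.1]⟩
        linarith
      bc0 := fun t ht => by simp [hv.bcπ t ht]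
      bcπ := fun t ht => by simp [hv.bc0 t ht] }

/-- A solution lies below the rarefaction barrier `K (x + 1) / t` before the final time. -/
theorem mul_le_barrier {K : ℝ} (hν : 0 < ν) (hT : T ≤ 1) (hK : 4 ≤ K)
    (hv : ShiftedBurgersSolution ν T h z zx v vt vx vxx)
    (hh : ∀ x ∈ Icc (0:ℝ) π, h x < K)
    (hz : ∀ t ∈ Icc (0:ℝ) T, ∀ x ∈ Icc (0:ℝ) π, |z t x| + |zx t x| ≤ 1)
    {t x : ℝ} (ht : t ∈ Ico 0 T) (hx : x ∈ Icc 0 π) : t * v t x ≤ K * (x + 1) := by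
  have hsub : Icc 0 t ⊆ Icc 0 T := Icc_subset_Icc_right ht.2.le
  have hcont : ContinuousOn (fun p : ℝ × ℝ => p.1 * v p.1 p.2 - K * (p.2 + 1))
      (Icc 0 t ×ˢ Icc 0 π) :=
    (continuousOn_fst.mul (hv.cont.mono (prod_mono_left hsub))).sub (by fun_prop)
  obtain ⟨⟨s, y⟩, ⟨hs, hy⟩, hmax⟩ :=
    (isCompact_Icc.prod isCompact_Icc).exists_isMaxOn
      ⟨(t, x), ⟨ht.1, le_rfl⟩, hx⟩ hcont
  have hmax' : ∀ τ ∈ Icc 0 t, ∀ ξ ∈ Icc 0 π,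
      τ * v τ ξ - K * (ξ + 1) ≤ s * v s y - K * (y + 1) := fun τ hτ ξ hξ =>
    hmax (show (τ, ξ) ∈ Icc 0 t ×ˢ Icc 0 π from ⟨hτ, hξ⟩)
  by_contra! hlt
  have hpos : 0 < s * v s y - K * (y + 1) := by
    linarith [hmax' t ⟨ht.1, le_rfl⟩ x hx]
  dsimp only at hs hy
  have hsT := hsub hs
  have hbar : 0 < K * (y + 1) := mul_pos (by linarith) (by linarith [hy.1])
  have hs0 : 0 < s := hs.1.lt_of_ne fun h0 => by
    rw [← h0, zero_mul] at hpos
    linarith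
  have hs1 : s < T := hs.2.trans_lt ht.2
  have hy0 : 0 < y := hy.1.lt_of_ne fun h0 => by
    have := hv.bc0 s hsT
    rw [← h0, this, mul_zero] at hpos
    linarith
  have hyπ : y < π := hy.2.lt_of_ne fun h0 => by
    have := hv.bcπ s hsT
    rw [h0, this, mul_zero] at hpos
    rw [h0] at hbar
    linarith
  have htime : 0 ≤ v s y + s * vt s y := by
    have hd : HasDerivWithinAt (fun τ => τ * v τ y - K * (y + 1))
        (1 * v s y + s * vt s y) (Icc 0 s) s :=
      ((hasDerivWithinAt_id s _).mul
        ((hv.hasDeriv_t s hsT y hy).mono (Icc_subset_Icc_right hs1.le))).sub_const _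
    have := hd.nonneg_of_isMaxOn_Icc hs0 fun τ hτ => hmax' τ ⟨hτ.1, hτ.2.trans hs.2⟩ y hy
    linarith
  have hnhds : ∀ᶠ ξ in 𝓝 y, ξ ∈ Ioo 0 π := Ioo_mem_nhds hy0 hyπ
  have hloc : IsLocalMax (fun ξ => s * v s ξ - K * (ξ + 1)) y :=
    hnhds.mono fun ξ hξ => hmax' s hs ξ (Ioo_subset_Icc_self hξ)
  have hderiv : ∀ ξ ∈ Ioo 0 π,
      HasDerivAt (fun ξ => s * v s ξ - K * (ξ + 1)) (s * vx s ξ - K) ξ := fun ξ hξ => by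
    have h₁ := ((hv.hasDeriv_x s hsT ξ (Ioo_subset_Icc_self hξ)).hasDerivAt
      (Icc_mem_nhds hξ.1 hξ.2)).const_mul s
    have h₂ := ((hasDerivAt_id ξ).add_const 1).const_mul K
    rw [mul_one] at h₂
    exact h₁.sub h₂
  have hvx : s * vx s y - K = 0 := hloc.hasDerivAt_eq_zero (hderiv y ⟨hy0, hyπ⟩)
  have hvxx : s * vxx s y ≤ 0 :=
    hloc.second_deriv_nonpos (hnhds.mono hderiv)
      ((((hv.hasDeriv_xx s hsT y hy).hasDerivAt (Icc_mem_nhds hy0 hyπ)).const_mul s).sub_const K)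
  have hvxx' : vxx s y ≤ 0 := nonpos_of_mul_nonpos_right hvxx hs0
  have heq := hv.eqn s ⟨hs0, hs1⟩ y ⟨hy0, hyπ⟩
  have hzb := hz s hsT y hy
  have hz1 : -1 ≤ z s y := by linarith [neg_abs_le (z s y), abs_nonneg (zx s y)]
  have hzx1 : -1 ≤ zx s y := by linarith [neg_abs_le (zx s y), abs_nonneg (z s y)]
  have hsle : s ≤ 1 := hs1.le.trans hT
  have hKvx : K ≤ vx s y := by nlinarith
  have hKv : K ≤ v s y := by nlinarith
  have hvt : -(v s y * vx s y / 4) ≤ vt s y := by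
    have h₁ : 0 ≤ s * (vt s y + v s y * vx s y / 4) := by
      have h₂ : s * (v s y * vx s y) = v s y * K := by linear_combination v s y * hvx
      nlinarith
    linarith [nonneg_of_mul_nonneg_right h₁ hs0]
  have hprod : (v s y - 1) * (vx s y - 1) ≤ (v s y + z s y) * (vx s y + zx s y) :=
    mul_le_mul (by linarith) (by linarith) (by linarith) (by linarith)
  have hdiff : ν * vxx s y ≤ 0 := mul_nonpos_of_nonneg_of_nonpos hν.le hvxx'
  have hhy := hh y hy
  nlinarith [mul_nonneg (by linarith : (0:ℝ) ≤ v s y - 4) (by linarith : (0:ℝ) ≤ vx s y - 4)]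

/-- The barrier bound at the final time `t = 1`. -/
theorem le_barrier_one {K : ℝ} (hν : 0 < ν) (hK : 4 ≤ K)
    (hv : ShiftedBurgersSolution ν 1 h z zx v vt vx vxx)
    (hh : ∀ x ∈ Icc (0:ℝ) π, h x < K)
    (hz : ∀ t ∈ Icc (0:ℝ) 1, ∀ x ∈ Icc (0:ℝ) π, |z t x| + |zx t x| ≤ 1)
    {x : ℝ} (hx : x ∈ Icc 0 π) : v 1 x ≤ K * (π + 1) := by
  have hc : ContinuousWithinAt (fun t => t * v t x) (Ico 0 1) 1 :=
    continuousWithinAt_id.mul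
      ((hv.hasDeriv_t 1 (by simp) x hx).continuousWithinAt.mono Ico_subset_Icc_self)
  have hne : (𝓝[Ico (0:ℝ) 1] 1).NeBot := by
    rw [nhdsWithin_Ico_eq_nhdsLT one_pos]
    infer_instance
  have hle : 1 * v 1 x ≤ K * (x + 1) := by
    refine le_of_tendsto hc ?_
    filter_upwards [self_mem_nhdsWithin] with t ht
    exact hv.mul_le_barrier hν le_rfl hK hh hz ht hx
  nlinarith [hx.2]

end ShiftedBurgersSolution

/-- Bound at time `t = 1`, independent of the initial condition: there are
`ρ > 0` and `R₁ > 0`, depending only on `ν` and `h₀`, such that whenever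
`sup |h| ≤ h₀` and `sup (|z| + |∂ₓ z|) ≤ ρ` on `[0,1] × [0,π]`, every classical
solution `v` of the shifted Burgers equation satisfies `sup_x |v(1,x)| ≤ R₁`. -/
theorem shifted_burgers_time_one_bound
    (ν h₀ : ℝ) (hν : 0 < ν) (hh₀ : 0 < h₀) :
    ∃ ρ > (0:ℝ), ∃ R₁ > (0:ℝ),
      ∀ (h : ℝ → ℝ), ContinuousOn h (Icc 0 π) →
        (∀ x ∈ Icc (0:ℝ) π, |h x| ≤ h₀) →
      ∀ (z zx : ℝ → ℝ → ℝ),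
        ContinuousOn (fun p : ℝ × ℝ => z p.1 p.2) (Icc 0 1 ×ˢ Icc 0 π) →
        ContinuousOn (fun p : ℝ × ℝ => zx p.1 p.2) (Icc 0 1 ×ˢ Icc 0 π) →
        (∀ t ∈ Icc (0:ℝ) 1, ∀ x ∈ Icc (0:ℝ) π,
          HasDerivWithinAt (fun y => z t y) (zx t x) (Icc 0 π) x) →
        (∀ t ∈ Icc (0:ℝ) 1, ∀ x ∈ Icc (0:ℝ) π, |z t x| + |zx t x| ≤ ρ) →
      ∀ (v vt vx vxx : ℝ → ℝ → ℝ),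
        ShiftedBurgersSolution ν 1 h z zx v vt vx vxx →
      ∀ x ∈ Icc (0:ℝ) π, |v 1 x| ≤ R₁ := by
  refine ⟨1, one_pos, (h₀ + 4) * (π + 1), by positivity, ?_⟩
  intro h _ hh z zx _ _ _ hz v vt vx vxx hv x hx
  have hmem : ∀ x ∈ Icc (0:ℝ) π, π - x ∈ Icc (0:ℝ) π := fun x hx =>
    ⟨by linarith [hx.2], by linarith [hx.1]⟩
  refine abs_le'.mpr ⟨?_, ?_⟩
  · exact hv.le_barrier_one hν (by linarith)
      (fun y hy => by linarith [le_abs_self (h y), hh y hy]) hz hx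
  · have := hv.reflect.le_barrier_one (K := h₀ + 4) hν (by linarith)
      (fun y hy => by linarith [neg_abs_le (h (π - y)), hh _ (hmem y hy)])
      (fun t ht y hy => by simpa using hz t ht _ (hmem y hy)) (hmem x hx)
    simpa using this
end

section
/- For every ν>0, h₀>0, ρ>0 and K>0 there exist δ>0 and M>0 such that for every ε∈(0,1) the function v₊(t,x) = (δ(x+M) + Kε)/(t+ε) satisfies: (i) the differential inequality ∂_t v₊ − ν ∂_x² v₊ + (v₊+z) ∂_x (v₊+z) − h(x) ≥ 0 for all (t,x)∈(0,1)×(0,π), whenever h:[0,π]→ℝ satisfies |h(x)| ≤ h₀ for all x and z:[0,1]×[0,π]→ℝ is continuous together with ∂_x z and satisfies |z(t,x)| ≤ ρ and |∂_x z(t,x)| ≤ ρ for all (t,x); (ii) v₊(t,0)>0 and v₊(t,π)>0 for t∈[0,1]; and (iii) v₊(0,x) ≥ K for all x∈[0,π]. (Thus v₊ is a supersolution of the shifted Burgers equation on (0,1)×(0,π).) -/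
open Real Set

/-- The residual inequality at a single point, where `s` is the shifted time, `N / s` the value of
the supersolution, `a` and `b` the values of the shift and of its derivative, and `c` the force. -/
lemma supersolution_residual_nonneg {ν h₀ ρ s N a b c : ℝ} (hρ : 0 ≤ ρ) (hh₀ : 0 ≤ h₀)
    (hs : 0 < s) (hs2 : s ≤ 2) (hN : (2 + 2 * ρ) * (2 * ρ + 4 * ρ ^ 2 + 4 * h₀) ≤ N)
    (ha : |a| ≤ ρ) (hb : |b| ≤ ρ) (hc : |c| ≤ h₀) :
    0 ≤ -(N / s ^ 2) - ν * 0 + (N / s + a) * ((2 + 2 * ρ) / s + b) - c := by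
  have hN0 : 0 ≤ N := le_trans (by positivity) hN
  have hsa : |s * a| ≤ 2 * ρ := by
    rw [abs_mul, abs_of_pos hs]; gcongr
  have hsb : |s * b| ≤ 2 * ρ := by
    rw [abs_mul, abs_of_pos hs]; gcongr
  have hsab : |s * a * (s * b)| ≤ 2 * ρ * (2 * ρ) := by
    rw [abs_mul]; gcongr
  have hsc : |s ^ 2 * c| ≤ 2 ^ 2 * h₀ := by
    rw [abs_mul, abs_of_pos (by positivity)]; gcongr
  have hNb : N * -(2 * ρ) ≤ N * (s * b) := mul_le_mul_of_nonneg_left (abs_le.1 hsb).1 hN0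
  have hδa : (2 + 2 * ρ) * -(2 * ρ) ≤ (2 + 2 * ρ) * (s * a) :=
    mul_le_mul_of_nonneg_left (abs_le.1 hsa).1 (by positivity)
  have hδ : 0 ≤ (1 + 2 * ρ) * (4 * ρ ^ 2 + 4 * h₀) := by positivity
  have key : -(N / s ^ 2) - ν * 0 + (N / s + a) * ((2 + 2 * ρ) / s + b) - c =
      (N * (1 + 2 * ρ) + N * (s * b) + (2 + 2 * ρ) * (s * a) + s * a * (s * b) - s ^ 2 * c)
        / s ^ 2 := by
    field_simp
    ring
  rw [key]
  apply div_nonneg _ (by positivity)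
  linarith [(abs_le.1 hsab).1, (abs_le.1 hsc).2]

/-- Construction of an explicit supersolution for the shifted Burgers equation:
for all `ν, h₀, ρ, K > 0` there are `δ > 0` and `M > 0` such that for every
`ε ∈ (0,1)` the function `v₊(t,x) = (δ(x+M) + Kε)/(t+ε)` satisfies
(i) `∂ₜ v₊ − ν ∂ₓ² v₊ + (v₊+z) ∂ₓ (v₊+z) − h(x) ≥ 0` on `(0,1) × (0,π)`
whenever `|h| ≤ h₀`, `|z| ≤ ρ`, `|∂ₓ z| ≤ ρ` (here `∂ₜ v₊ = −(δ(x+M)+Kε)/(t+ε)²`,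
`∂ₓ v₊ = δ/(t+ε)`, `∂ₓ² v₊ = 0`);
(ii) `v₊(t,0) > 0` and `v₊(t,π) > 0` for `t ∈ [0,1]`;
(iii) `v₊(0,x) ≥ K` for `x ∈ [0,π]`. -/
theorem burgers_supersolution
    (ν h₀ ρ K : ℝ) (hν : 0 < ν) (hh₀ : 0 < h₀) (hρ : 0 < ρ) (hK : 0 < K) :
    ∃ δ > (0:ℝ), ∃ M > (0:ℝ), ∀ ε ∈ Ioo (0:ℝ) 1,
      -- (i) the differential inequality
      (∀ (h : ℝ → ℝ), (∀ x ∈ Icc (0:ℝ) π, |h x| ≤ h₀) →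
       ∀ (z zx : ℝ → ℝ → ℝ),
         ContinuousOn (fun p : ℝ × ℝ => z p.1 p.2) (Icc 0 1 ×ˢ Icc 0 π) →
         ContinuousOn (fun p : ℝ × ℝ => zx p.1 p.2) (Icc 0 1 ×ˢ Icc 0 π) →
         (∀ t ∈ Icc (0:ℝ) 1, ∀ x ∈ Icc (0:ℝ) π,
           HasDerivWithinAt (fun y => z t y) (zx t x) (Icc 0 π) x) →
         (∀ t ∈ Icc (0:ℝ) 1, ∀ x ∈ Icc (0:ℝ) π, |z t x| ≤ ρ) →
         (∀ t ∈ Icc (0:ℝ) 1, ∀ x ∈ Icc (0:ℝ) π, |zx t x| ≤ ρ) →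
         ∀ t ∈ Ioo (0:ℝ) 1, ∀ x ∈ Ioo (0:ℝ) π,
           0 ≤ -((δ * (x + M) + K * ε) / (t + ε) ^ 2) - ν * 0
               + ((δ * (x + M) + K * ε) / (t + ε) + z t x)
                 * (δ / (t + ε) + zx t x)
               - h x) ∧
      -- (ii) positivity on the lateral boundary
      (∀ t ∈ Icc (0:ℝ) 1,
        0 < (δ * ((0:ℝ) + M) + K * ε) / (t + ε) ∧
        0 < (δ * (π + M) + K * ε) / (t + ε)) ∧
      -- (iii) bound from below at time zero
      (∀ x ∈ Icc (0:ℝ) π, K ≤ (δ * (x + M) + K * ε) / ((0:ℝ) + ε)) := by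
  have hM : 0 < 2 * ρ + 4 * ρ ^ 2 + 4 * h₀ := by positivity
  refine ⟨2 + 2 * ρ, by positivity, 2 * ρ + 4 * ρ ^ 2 + 4 * h₀, hM, ?_⟩
  rintro ε ⟨hε0, hε1⟩
  refine ⟨?_, ?_, ?_⟩
  · intro h hh z zx _ _ _ hz hzx t ht x hx
    have ht' := Ioo_subset_Icc_self ht
    have hx' := Ioo_subset_Icc_self hx
    exact supersolution_residual_nonneg hρ.le hh₀.le (by linarith [ht.1]) (by linarith [ht.2])
      (by nlinarith [mul_nonneg hρ.le hx.1.le, mul_pos hK hε0, hx.1]) (hz t ht' x hx')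
      (hzx t ht' x hx') (hh x hx')
  · rintro t ⟨ht0, -⟩
    have := pi_pos
    constructor <;> positivity
  · rintro x ⟨hx0, -⟩
    rw [le_div_iff₀ (by linarith), zero_add]
    have : 0 ≤ (2 + 2 * ρ) * (x + (2 * ρ + 4 * ρ ^ 2 + 4 * h₀)) := by positivity
    linarith
end

section
/- Fix s∈(1,2] and set θ_s = 3/(2s+1). There exists a constant C>0 such that for every real sequence (a_k)_{k≥1} with Σ_{k=1}^∞ k^{2s} a_k² < ∞, the function u(x) = Σ_{k=1}^∞ a_k sin(kx) on [0,π] satisfies (Σ_{k=1}^∞ k² a_k²)^{1/2} ≤ C (∫₀^π |u(x)| dx)^{1−θ_s} (Σ_{k=1}^∞ k^{2s} a_k²)^{θ_s/2}. (This is the interpolation inequality ‖u‖_{H¹} ≤ C ‖u‖_{L¹}^{1−θ_s} ‖u‖_{H^s}^{θ_s} for functions on (0,π) with Dirichlet boundary conditions, with the Sobolev norms expressed spectrally in the sine basis.) -/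
open Real Set MeasureTheory

lemma integral_cos_int_mul (j : ℤ) :
    ∫ x in (0:ℝ)..π, Real.cos (j * x) = if j = 0 then π else 0 := by
  split_ifs with h
  · simp [h]
  · have hj : (j : ℝ) ≠ 0 := by exact_mod_cast h
    rw [intervalIntegral.integral_comp_mul_left (fun x => Real.cos x) hj]
    simp [Real.sin_int_mul_pi]

lemma integral_sin_mul_sin (k m : ℕ) (hm : m ≠ 0) :
    ∫ x in (0:ℝ)..π, Real.sin (k * x) * Real.sin (m * x) = if k = m then π / 2 else 0 := by
  have h : ∀ x : ℝ, Real.sin (k * x) * Real.sin (m * x) =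
      (Real.cos (((k - m : ℤ) : ℝ) * x) - Real.cos (((k + m : ℤ) : ℝ) * x)) / 2 := by
    intro x
    push_cast
    rw [sub_mul, add_mul, Real.cos_sub, Real.cos_add]
    ring
  simp_rw [h]
  rw [intervalIntegral.integral_div, intervalIntegral.integral_sub
    (Continuous.intervalIntegrable (by fun_prop) _ _)
    (Continuous.intervalIntegrable (by fun_prop) _ _),
    integral_cos_int_mul, integral_cos_int_mul]
  have h1 : ((k : ℤ) + m) ≠ 0 := by omega
  by_cases hk : k = m
  · subst hk
    simp [h1]
  · have h2 : ((k : ℤ) - m) ≠ 0 := by omega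
    simp [h1, h2, hk]

lemma continuous_sine_series {a : ℕ → ℝ} (ha : Summable fun k => |a k|) :
    Continuous fun x : ℝ => ∑' k : ℕ, a k * Real.sin (k * x) := by
  refine continuous_tsum (fun k => by fun_prop) ha fun k x => ?_
  rw [Real.norm_eq_abs, abs_mul]
  exact mul_le_of_le_one_right (abs_nonneg _) (Real.abs_sin_le_one _)

lemma integral_sine_series_mul_sin {a : ℕ → ℝ} (ha : Summable fun k => |a k|)
    {m : ℕ} (hm : m ≠ 0) :
    ∫ x in (0:ℝ)..π, (∑' k : ℕ, a k * Real.sin (k * x)) * Real.sin (m * x) = π / 2 * a m := by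
  have hterm : ∀ (k : ℕ) (x : ℝ), ‖a k * Real.sin (k * x) * Real.sin (m * x)‖ ≤ |a k| := by
    intro k x
    rw [Real.norm_eq_abs, abs_mul, abs_mul, mul_assoc]
    exact mul_le_of_le_one_right (abs_nonneg _)
      (mul_le_one₀ (Real.abs_sin_le_one _) (abs_nonneg _) (Real.abs_sin_le_one _))
  have hsum : HasSum (fun k => ∫ x in (0:ℝ)..π, a k * Real.sin (k * x) * Real.sin (m * x))
      (∫ x in (0:ℝ)..π, ∑' k : ℕ, a k * Real.sin (k * x) * Real.sin (m * x)) := by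
    refine intervalIntegral.hasSum_integral_of_dominated_convergence (fun k _ => |a k|)
      (fun k => (Continuous.aestronglyMeasurable (by fun_prop)))
      (fun k => Filter.Eventually.of_forall fun x _ => hterm k x)
      (Filter.Eventually.of_forall fun x _ => ha) (by simp)
      (Filter.Eventually.of_forall fun x _ => ?_)
    exact (Summable.of_norm_bounded ha fun k => hterm k x).hasSum
  simp_rw [← tsum_mul_right]
  rw [← hsum.tsum_eq, tsum_eq_single m]
  · simp_rw [mul_assoc]
    rw [intervalIntegral.integral_const_mul, integral_sin_mul_sin _ _ hm]
    simp [mul_comm]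
  · intro k hk
    simp_rw [mul_assoc]
    rw [intervalIntegral.integral_const_mul, integral_sin_mul_sin _ _ hm]
    simp [hk]

lemma abs_sine_coeff_le {a : ℕ → ℝ} (ha : Summable fun k => |a k|) {m : ℕ} (hm : m ≠ 0) :
    |a m| ≤ ∫ x in (0:ℝ)..π, |∑' k : ℕ, a k * Real.sin (k * x)| := by
  have hc := continuous_sine_series ha
  have h1 : π / 2 * |a m| ≤ ∫ x in (0:ℝ)..π, |∑' k : ℕ, a k * Real.sin (k * x)| := by
    calc π / 2 * |a m|
        = |∫ x in (0:ℝ)..π, (∑' k : ℕ, a k * Real.sin (k * x)) * Real.sin (m * x)| := by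
          rw [integral_sine_series_mul_sin ha hm, abs_mul, abs_of_pos Real.pi_div_two_pos]
      _ ≤ ∫ x in (0:ℝ)..π, |(∑' k : ℕ, a k * Real.sin (k * x)) * Real.sin (m * x)| :=
          intervalIntegral.abs_integral_le_integral_abs Real.pi_pos.le
      _ ≤ _ := by
          refine intervalIntegral.integral_mono_on Real.pi_pos.le
            (Continuous.intervalIntegrable (by fun_prop) _ _)
            (Continuous.intervalIntegrable (by fun_prop) _ _) fun x _ => ?_
          rw [abs_mul]
          exact mul_le_of_le_one_right (abs_nonneg _) (Real.abs_sin_le_one _)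
  nlinarith [Real.two_le_pi, abs_nonneg (a m)]

lemma summable_abs_of_summable_rpow_mul_sq {s : ℝ} (hs : 1 < 2 * s) {a : ℕ → ℝ}
    (ha : Summable fun k : ℕ => (k:ℝ) ^ (2*s) * (a k) ^ 2) : Summable fun k => |a k| := by
  have h := ha.add (Real.summable_nat_rpow_inv.2 hs)
  refine Summable.of_norm_bounded_eventually_nat h ?_
  filter_upwards [Filter.eventually_gt_atTop 0] with k hk
  rw [Real.norm_eq_abs, abs_abs]
  have hp : 0 < (k:ℝ) ^ (2*s) := by positivity
  set p := (k:ℝ) ^ (2*s)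
  rw [← sq_abs (a k)]
  have key : p * |a k| ^ 2 + p⁻¹ - |a k| = p * (|a k| - p⁻¹ / 2) ^ 2 + 3 / 4 * p⁻¹ := by
    field_simp
    ring
  have : 0 ≤ p * (|a k| - p⁻¹ / 2) ^ 2 + 3 / 4 * p⁻¹ := by positivity
  linarith

/-- Splitting the sum at frequency `N`, with the low frequencies estimated by the uniform bound
on the coefficients and the high ones by the stronger norm. -/
lemma tsum_sq_mul_sq_le_add {s : ℝ} (hs : 1 ≤ s) {a : ℕ → ℝ}
    (ha : Summable fun k : ℕ => (k:ℝ) ^ (2*s) * (a k) ^ 2) {M : ℝ}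
    (hM : ∀ k ≠ 0, |a k| ≤ M) {N : ℝ} (hN : 0 < N) :
    ∑' k : ℕ, (k:ℝ) ^ 2 * (a k) ^ 2 ≤
      N ^ 3 * M ^ 2 + N ^ (2 - 2*s) * ∑' k : ℕ, (k:ℝ) ^ (2*s) * (a k) ^ 2 := by
  set S := Finset.Icc 1 ⌊N⌋₊ with hS
  have hlow : HasSum (fun k => if k ∈ S then N ^ 2 * M ^ 2 else 0)
      (∑ k ∈ S, if k ∈ S then N ^ 2 * M ^ 2 else 0) :=
    hasSum_sum_of_ne_finset_zero fun k hk => by simp [hk]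
  have hbound : ∀ k : ℕ, (k:ℝ) ^ 2 * (a k) ^ 2 ≤
      (if k ∈ S then N ^ 2 * M ^ 2 else 0) + N ^ (2 - 2*s) * ((k:ℝ) ^ (2*s) * (a k) ^ 2) := by
    intro k
    have hnn : 0 ≤ N ^ (2 - 2*s) * ((k:ℝ) ^ (2*s) * (a k) ^ 2) := by positivity
    rcases Nat.eq_zero_or_pos k with rfl | hk
    · have : 0 ≤ (if 0 ∈ S then N ^ 2 * M ^ 2 else 0) := by positivity
      simpa using add_nonneg this hnn
    split_ifs with h
    · have hkN : (k:ℝ) ≤ N := (Nat.le_floor_iff hN.le).1 (Finset.mem_Icc.1 h).2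
      have : (k:ℝ) ^ 2 * (a k) ^ 2 ≤ N ^ 2 * M ^ 2 := by
        rw [← sq_abs (a k)]
        gcongr
        exact hM k hk.ne'
      linarith
    · have hkN : N ≤ k := by
        by_contra! hlt
        exact h (Finset.mem_Icc.2 ⟨hk, Nat.le_floor hlt.le⟩)
      have hk' : (0:ℝ) < k := by exact_mod_cast hk
      have h1 : (k:ℝ) ^ 2 = (k:ℝ) ^ (2 - 2*s) * (k:ℝ) ^ (2*s) := by
        rw [← Real.rpow_add hk', sub_add_cancel, Real.rpow_two]
      rw [h1, zero_add, mul_assoc]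
      exact mul_le_mul_of_nonneg_right
        (Real.rpow_le_rpow_of_nonpos hN hkN (by linarith)) (by positivity)
  have hsum := hlow.summable.add (ha.mul_left (N ^ (2 - 2*s)))
  calc ∑' k : ℕ, (k:ℝ) ^ 2 * (a k) ^ 2
      ≤ ∑' k : ℕ, ((if k ∈ S then N ^ 2 * M ^ 2 else 0) +
          N ^ (2 - 2*s) * ((k:ℝ) ^ (2*s) * (a k) ^ 2)) :=
        (Summable.of_nonneg_of_le (fun k => by positivity) hbound hsum).tsum_le_tsum hbound hsum
    _ = ⌊N⌋₊ * (N ^ 2 * M ^ 2) + N ^ (2 - 2*s) * ∑' k : ℕ, (k:ℝ) ^ (2*s) * (a k) ^ 2 := by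
        rw [hlow.summable.tsum_add (ha.mul_left _), hlow.tsum_eq, tsum_mul_left,
          Finset.sum_congr rfl fun k hk => if_pos hk]
        simp [hS]
    _ ≤ N * (N ^ 2 * M ^ 2) + N ^ (2 - 2*s) * ∑' k : ℕ, (k:ℝ) ^ (2*s) * (a k) ^ 2 := by
        gcongr
        exact Nat.floor_le hN.le
    _ = _ := by ring

/-- Spectral interpolation inequality `‖u‖_{H¹} ≤ C ‖u‖_{L¹}^{1−θ_s} ‖u‖_{H^s}^{θ_s}`
with `θ_s = 3/(2s+1)`, for functions `u(x) = Σ_{k≥1} a_k sin(kx)` on `(0,π)` with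
Dirichlet boundary conditions, the Sobolev norms being expressed in the sine
basis (the `k = 0` terms all vanish). -/
theorem spectral_interpolation_H1_L1_Hs
    (s : ℝ) (hs : s ∈ Ioc (1:ℝ) 2) :
    ∃ C > (0:ℝ),
      ∀ a : ℕ → ℝ,
        Summable (fun k : ℕ => (k:ℝ) ^ (2*s) * (a k) ^ 2) →
        (∑' k : ℕ, (k:ℝ) ^ 2 * (a k) ^ 2) ^ ((1:ℝ)/2) ≤
          C * (∫ x in (0:ℝ)..π, |∑' k : ℕ, a k * Real.sin (k * x)|) ^ (1 - 3/(2*s+1))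
            * (∑' k : ℕ, (k:ℝ) ^ (2*s) * (a k) ^ 2) ^ ((3/(2*s+1))/2) := by
  obtain ⟨hs1, -⟩ := hs
  refine ⟨2 ^ ((1:ℝ)/2), by positivity, fun a ha => ?_⟩
  have hcoeff : ∀ k ≠ 0, |a k| ≤ ∫ x in (0:ℝ)..π, |∑' k : ℕ, a k * Real.sin (k * x)| :=
    fun k hk => abs_sine_coeff_le (summable_abs_of_summable_rpow_mul_sq (by linarith) ha) hk
  have hL0 : 0 ≤ ∫ x in (0:ℝ)..π, |∑' k : ℕ, a k * Real.sin (k * x)| :=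
    intervalIntegral.integral_nonneg Real.pi_pos.le fun x _ => abs_nonneg _
  have hB0 : 0 ≤ ∑' k : ℕ, (k:ℝ) ^ (2*s) * (a k) ^ 2 := tsum_nonneg fun k => by positivity
  by_cases hzero : ∀ k ≠ 0, a k = 0
  · have : ∀ k : ℕ, (k:ℝ) ^ 2 * (a k) ^ 2 = 0 := by
      intro k
      by_cases hk : k = 0
      · simp [hk]
      · simp [hzero k hk]
    simp_rw [this]
    rw [tsum_zero, Real.zero_rpow (by norm_num)]
    positivity
  push Not at hzero
  obtain ⟨m, hm, ham⟩ := hzero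
  have hL : 0 < ∫ x in (0:ℝ)..π, |∑' k : ℕ, a k * Real.sin (k * x)| :=
    (abs_pos.2 ham).trans_le (hcoeff m hm)
  have hB : 0 < ∑' k : ℕ, (k:ℝ) ^ (2*s) * (a k) ^ 2 :=
    ha.tsum_pos (fun k => by positivity) m (by positivity)
  have hsplit := fun {N : ℝ} (hN : 0 < N) => tsum_sq_mul_sq_le_add hs1.le ha hcoeff hN
  have hA0 : 0 ≤ ∑' k : ℕ, (k:ℝ) ^ 2 * (a k) ^ 2 := tsum_nonneg fun k => by positivity
  generalize (∫ x in (0:ℝ)..π, |∑' k : ℕ, a k * Real.sin (k * x)|) = L at *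
  generalize (∑' k : ℕ, (k:ℝ) ^ (2*s) * (a k) ^ 2) = B at *
  generalize (∑' k : ℕ, (k:ℝ) ^ 2 * (a k) ^ 2) = A at *
  have hd : 2 * s + 1 ≠ 0 := by linarith
  have hQ : 0 < B / L ^ 2 := by positivity
  have hN : 0 < (B / L ^ 2) ^ (1 / (2*s+1)) := by positivity
  have hA := hsplit hN
  have hcube : ((B / L ^ 2) ^ (1 / (2*s+1))) ^ 3 = (B / L ^ 2) ^ (3 / (2*s+1)) := by
    rw [← Real.rpow_natCast, ← Real.rpow_mul hQ.le]
    congr 1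
    push_cast
    ring
  have htail : ((B / L ^ 2) ^ (1 / (2*s+1))) ^ (2 - 2*s) * B
      = (B / L ^ 2) ^ (3 / (2*s+1)) * L ^ 2 := by
    rw [← Real.rpow_mul hQ.le,
      show 1 / (2*s+1) * (2 - 2*s) = 3 / (2*s+1) - 1 by field_simp; ring,
      Real.rpow_sub_one hQ.ne']
    field_simp
  rw [hcube, htail, ← two_mul] at hA
  calc A ^ ((1:ℝ)/2)
      ≤ (2 * ((B / L ^ 2) ^ (3 / (2*s+1)) * L ^ 2)) ^ ((1:ℝ)/2) := by gcongr
    _ = _ := by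
      rw [Real.mul_rpow (by positivity) (by positivity), mul_assoc,
        Real.div_rpow hB.le (by positivity), ← Real.rpow_two, ← Real.rpow_mul hL.le,
        div_mul_eq_mul_div, mul_div_assoc, ← Real.rpow_sub hL,
        Real.mul_rpow (by positivity) (by positivity), ← Real.rpow_mul hB.le,
        ← Real.rpow_mul hL.le, mul_comm (B ^ _)]
      congr 3 <;> ring
end

section
/- Let ν>0 and let h:[0,π]→ℝ be continuous. Then there exists a twice continuously differentiable function û:[0,π]→ℝ such that −ν û''(x) + û(x) û'(x) = h(x) for all x∈(0,π) and û(0) = û(π) = 0. (Existence of a time-independent solution of the unforced stochastic Burgers problem, i.e. of the stationary Burgers boundary value problem.) -/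
open Real Set
open scoped NNReal

/-- A bounded Lipschitz autonomous scalar field with continuous forcing has a solution on all of
`[0, T]`. -/
theorem exists_solution_of_bounded_lipschitz {T : ℝ} (hT : 0 ≤ T) {F g : ℝ → ℝ} {L : ℝ≥0}
    {B : ℝ} (hF : LipschitzWith L F) (hB : ∀ y, |F y| ≤ B) (hg : ContinuousOn g (Icc 0 T)) :
    ∃ u : ℝ → ℝ, u 0 = 0 ∧
      ∀ x ∈ Icc 0 T, HasDerivWithinAt u (F (u x) + g x) (Icc 0 T) x := by
  obtain ⟨K, hK⟩ := isCompact_Icc.exists_bound_of_continuousOn hg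
  have hB0 : 0 ≤ B := (abs_nonneg _).trans (hB 0)
  have hK0 : 0 ≤ K := (norm_nonneg _).trans (hK 0 ⟨le_rfl, hT⟩)
  have hp : IsPicardLindelof (fun x y => F y + g x) (⟨0, le_rfl, hT⟩ : Icc 0 T) (0 : ℝ)
      (⟨(B + K) * T, by positivity⟩ : ℝ≥0) 0 ⟨B + K, by positivity⟩ L :=
    { lipschitzOnWith := fun t _ => by
        refine LipschitzWith.lipschitzOnWith (LipschitzWith.of_dist_le_mul fun y z => ?_)
        simpa using hF.dist_le_mul y z
      continuousOn := fun y _ => continuousOn_const.add hg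
      norm_le := fun t ht y _ =>
        (norm_add_le _ _).trans (add_le_add (hB y) (hK t ht))
      mul_max_le := by
        change (B + K) * max (T - 0) (0 - 0) ≤ (B + K) * T - 0
        simp [hT] }
  exact hp.exists_eq_forall_mem_Icc_hasDerivWithinAt₀

/-- Shooting: the additive constant in the vector field can be chosen so that the solution
vanishes at both ends of the interval. -/
theorem exists_parameter_two_point {T : ℝ} (hT : 0 < T) {F G : ℝ → ℝ} {L : ℝ≥0} {B K : ℝ}
    (hF : LipschitzWith L F) (hB : ∀ y, |F y| ≤ B) (hF_nonneg : ∀ y, 0 ≤ F y) (hF_zero : F 0 = 0)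
    (hG : ContinuousOn G (Icc 0 T)) (hK : ∀ x ∈ Icc 0 T, |G x| < K) :
    ∃ c ∈ Icc (-K) K, ∃ u : ℝ → ℝ, u 0 = 0 ∧ u T = 0 ∧
      ∀ x ∈ Icc 0 T, HasDerivWithinAt u (F (u x) + (c - G x)) (Icc 0 T) x := by
  choose u hu₀ hu using fun c : ℝ =>
    exists_solution_of_bounded_lipschitz hT.le hF hB (g := fun x => c - G x)
      (continuousOn_const.sub hG)
  have hcont (c) : ContinuousOn (u c) (Icc 0 T) := fun x hx => (hu c x hx).continuousWithinAt
  have hright (c x) (hx : x ∈ Ico 0 T) :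
      HasDerivWithinAt (u c) (F (u c x) + (c - G x)) (Ici x) x :=
    (hu c x (Ico_subset_Icc_self hx)).mono_of_mem_nhdsWithin (Icc_mem_nhdsGE_of_mem hx)
  have hK0 : 0 < K := (abs_nonneg _).trans_lt (hK 0 ⟨le_rfl, hT.le⟩)
  have hdist (c d : ℝ) : dist (u d T) (u c T) ≤ gronwallBound 0 L |d - c| T := by
    have := dist_le_of_approx_trajectories_ODE (v := fun x y => F y + (c - G x)) (K := L)
      (a := 0) (b := T) (f := u d) (g := u c) (εf := |d - c|) (εg := 0) (δ := 0)
      (fun x => LipschitzWith.of_dist_le_mul fun y z => by simpa using hF.dist_le_mul y z)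
      (hcont d) (hright d) (fun x _ => by simp [Real.dist_eq]) (hcont c) (hright c)
      (fun x _ => by simp) (by simp [hu₀]) T ⟨hT.le, le_rfl⟩
    simpa using this
  have hcontT : Continuous fun c => u c T := by
    refine continuous_iff_continuousAt.2 fun c => tendsto_iff_dist_tendsto_zero.2 ?_
    have hlim : Filter.Tendsto (fun d => gronwallBound 0 L |d - c| T) (nhds c) (nhds 0) := by
      have : Continuous fun d => gronwallBound 0 L |d - c| T :=
        (gronwallBound_continuous_ε 0 L T).comp (by fun_prop)
      simpa [gronwallBound_ε0_δ0] using this.tendsto c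
    exact squeeze_zero (fun _ => dist_nonneg) (hdist c) hlim
  have hneg : u (-K) T ≤ 0 := by
    refine image_le_of_deriv_right_lt_deriv_boundary (hcont _) (hright _) (hu₀ _).le
      (B := fun _ => 0) (B' := fun _ => 0) (fun x => hasDerivAt_const x 0) (fun x hx h0 => ?_)
      ⟨hT.le, le_rfl⟩
    rw [h0, hF_zero]
    linarith [neg_lt_of_abs_lt (hK x (Ico_subset_Icc_self hx))]
  have hpos : 0 ≤ u K T := by
    have hmono : MonotoneOn (u K) (Icc 0 T) :=
      monotoneOn_of_hasDerivWithinAt_nonneg (convex_Icc 0 T) (hcont K)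
        (fun x hx => (hu K x (interior_subset hx)).mono interior_subset) fun x hx => by
          linarith [hF_nonneg (u K x), lt_of_abs_lt (hK x (interior_subset hx))]
    simpa [hu₀] using hmono (left_mem_Icc.2 hT.le) (right_mem_Icc.2 hT.le) hT.le
  obtain ⟨c, hc, hc0⟩ :=
    intermediate_value_Icc (by linarith : -K ≤ K) hcontT.continuousOn ⟨hneg, hpos⟩
  exact ⟨c, hc, u c, hu₀ c, hc0, hu c⟩

/-- A function vanishing at both ends of `[0, T]` whose derivative is at least `-A` is bounded by
`A * T`. -/
theorem abs_le_of_hasDerivWithinAt_ge {T A : ℝ} {u u' : ℝ → ℝ} (hA : 0 ≤ A)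
    (hu : ∀ x ∈ Icc 0 T, HasDerivWithinAt u (u' x) (Icc 0 T) x)
    (hu' : ∀ x ∈ Icc 0 T, -A ≤ u' x) (h0 : u 0 = 0) (hT : u T = 0) {x : ℝ} (hx : x ∈ Icc 0 T) :
    |u x| ≤ A * T := by
  have hd (y) (hy : y ∈ Icc 0 T) :
      HasDerivWithinAt (fun y => u y + A * y) (u' y + A * 1) (Icc 0 T) y :=
    (hu y hy).add ((hasDerivWithinAt_id y _).const_mul A)
  have hmono : MonotoneOn (fun y => u y + A * y) (Icc 0 T) :=
    monotoneOn_of_hasDerivWithinAt_nonneg (convex_Icc 0 T)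
      (fun y hy => (hd y hy).continuousWithinAt)
      (fun y hy => (hd y (interior_subset hy)).mono interior_subset) fun y hy => by
        linarith [hu' y (interior_subset hy)]
  have hT0 : 0 ≤ T := hx.1.trans hx.2
  have h1 := hmono (left_mem_Icc.2 hT0) hx hx.1
  have h2 := hmono hx (right_mem_Icc.2 hT0) hx.2
  simp only [h0, hT] at h1 h2
  have h3 : A * x ≤ A * T := mul_le_mul_of_nonneg_left hx.2 hA
  have h4 : 0 ≤ A * x := mul_nonneg hA hx.1
  exact abs_le.2 ⟨by linarith, by linarith⟩

/-- The square truncated at height `M`. -/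
noncomputable def truncatedSq (M y : ℝ) : ℝ := min |y| M ^ 2

theorem truncatedSq_of_abs_le {M y : ℝ} (h : |y| ≤ M) : truncatedSq M y = y ^ 2 := by
  rw [truncatedSq, min_eq_left h, sq_abs]

theorem truncatedSq_le {M : ℝ} (hM : 0 ≤ M) (y : ℝ) : truncatedSq M y ≤ M ^ 2 :=
  pow_le_pow_left₀ (le_min (abs_nonneg y) hM) (min_le_right _ _) 2

theorem lipschitzWith_truncatedSq (M : ℝ≥0) : LipschitzWith (2 * M) (truncatedSq M) := by
  refine LipschitzWith.of_dist_le_mul fun y z => ?_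
  have h1 : |min |y| (M : ℝ) - min |z| M| ≤ |y - z| := by
    refine (abs_min_sub_min_le_max _ _ _ _).trans ?_
    simpa using abs_abs_sub_abs_le_abs_sub y z
  have hy : 0 ≤ min |y| (M : ℝ) := le_min (abs_nonneg y) M.2
  have hz : 0 ≤ min |z| (M : ℝ) := le_min (abs_nonneg z) M.2
  have h2 : |min |y| (M : ℝ) + min |z| M| ≤ 2 * M := by
    rw [abs_of_nonneg (add_nonneg hy hz)]
    linarith [min_le_right |y| (M : ℝ), min_le_right |z| (M : ℝ)]
  rw [Real.dist_eq, Real.dist_eq, truncatedSq, truncatedSq, sq_sub_sq, abs_mul]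
  exact mul_le_mul h2 h1 (abs_nonneg _) (2 * M).2

/-- Existence of a stationary solution of the Burgers equation: for every
`ν > 0` and continuous `h : [0,π] → ℝ` there is a twice continuously
differentiable function `û : [0,π] → ℝ` (with first and second derivatives
`u1 = û'`, `u2 = û''` on `[0,π]`) such that `−ν û'' + û û' = h` on `(0,π)`
and `û(0) = û(π) = 0`. -/
theorem stationary_burgers_exists
    (ν : ℝ) (hν : 0 < ν) (h : ℝ → ℝ) (hh : ContinuousOn h (Icc 0 π)) :
    ∃ u u1 u2 : ℝ → ℝ,
      (∀ x ∈ Icc (0:ℝ) π, HasDerivWithinAt u (u1 x) (Icc 0 π) x) ∧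
      (∀ x ∈ Icc (0:ℝ) π, HasDerivWithinAt u1 (u2 x) (Icc 0 π) x) ∧
      ContinuousOn u2 (Icc 0 π) ∧
      (∀ x ∈ Ioo (0:ℝ) π, -ν * u2 x + u x * u1 x = h x) ∧
      u 0 = 0 ∧ u π = 0 := by
  obtain ⟨H, hH⟩ : ∃ H : ℝ → ℝ, ∀ x ∈ Icc 0 π, HasDerivWithinAt H (h x) (Icc 0 π) x := by
    have hc : Continuous (IccExtend pi_pos.le ((Icc 0 π).domRestrict h)) :=
      (continuousOn_iff_continuous_domRestrict.1 hh).Icc_extend'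
    refine ⟨fun x => ∫ t in (0 : ℝ)..x, IccExtend pi_pos.le ((Icc 0 π).domRestrict h) t,
      fun x hx => ?_⟩
    have := (hc.integral_hasStrictDerivAt 0 x).hasDerivAt.hasDerivWithinAt (s := Icc 0 π)
    rwa [IccExtend_of_mem _ _ hx] at this
  have hHc : ContinuousOn H (Icc 0 π) := fun x hx => (hH x hx).continuousWithinAt
  obtain ⟨K₀, hK₀⟩ := isCompact_Icc.exists_bound_of_continuousOn (hHc.div_const ν)
  have hK (x) (hx : x ∈ Icc 0 π) : |H x / ν| < K₀ + 1 := (hK₀ x hx).trans_lt (by linarith)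
  have hK0 : 0 < K₀ + 1 := (abs_nonneg _).trans_lt (hK 0 ⟨le_rfl, pi_pos.le⟩)
  let M : ℝ≥0 := ⟨2 * (K₀ + 1) * π, by positivity⟩
  have hnonneg (y : ℝ) : 0 ≤ (2 * ν)⁻¹ * truncatedSq M y := by
    unfold truncatedSq; positivity
  obtain ⟨c, hc, u, hu0, huπ, hu⟩ := exists_parameter_two_point pi_pos
    (F := fun y => (2 * ν)⁻¹ * truncatedSq M y) (G := fun x => H x / ν)
    (L := (2 * ν)⁻¹.toNNReal * (2 * M)) (B := (2 * ν)⁻¹ * (M : ℝ) ^ 2)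
    (LipschitzWith.of_dist_le_mul fun y z => by
      rw [Real.dist_eq, ← mul_sub, abs_mul, abs_of_pos (by positivity), NNReal.coe_mul,
        Real.coe_toNNReal _ (by positivity), mul_assoc]
      exact mul_le_mul_of_nonneg_left ((lipschitzWith_truncatedSq M).dist_le_mul y z)
        (by positivity))
    (fun y => by
      rw [abs_of_nonneg (hnonneg y)]
      exact mul_le_mul_of_nonneg_left (truncatedSq_le M.2 y) (by positivity))
    hnonneg (by simp [truncatedSq]) (hHc.div_const ν) hK
  have hbound (x) (hx : x ∈ Icc 0 π) : |u x| ≤ M :=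
    abs_le_of_hasDerivWithinAt_ge (by positivity) hu
      (fun y hy => by linarith [hnonneg (u y), lt_of_abs_lt (hK y hy), hc.1]) hu0 huπ hx
  have hu1 (x) (hx : x ∈ Icc 0 π) :
      HasDerivWithinAt u ((2 * ν)⁻¹ * u x ^ 2 + (c - H x / ν)) (Icc 0 π) x := by
    simpa only [truncatedSq_of_abs_le (hbound x hx)] using hu x hx
  have huc : ContinuousOn u (Icc 0 π) := fun x hx => (hu x hx).continuousWithinAt
  refine ⟨u, fun x => (2 * ν)⁻¹ * u x ^ 2 + (c - H x / ν),
    fun x => (u x * ((2 * ν)⁻¹ * u x ^ 2 + (c - H x / ν)) - h x) / ν, hu1, fun x hx => ?_,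
    by fun_prop, fun x _ => ?_, hu0, huπ⟩
  · refine ((((hu1 x hx).pow 2).const_mul (2 * ν)⁻¹).add
      (((hH x hx).div_const ν).const_sub c)).congr_deriv ?_
    push_cast
    field_simp
    ring
  · field_simp
    ring
end

section
/- There exists a constant C>0 with the following property. Let ν>0, T>0, let f:[0,T]×[0,π]→ℝ be continuous, and let u, u' be two classical solutions of the forced Burgers equation ∂_t w − ν ∂_x² w + w ∂_x w = f(t,x) on [0,T]×[0,π] with Dirichlet boundary conditions. Then for every t∈[0,T], ( ∫₀^π |∂_x u(t,x) − ∂_x u'(t,x)|² dx )^{1/2} ≤ C ( ∫₀^π |u(0,x) − u'(0,x)| dx )^{2/5} ( ‖∂_x² u(t,·)‖_{L²(0,π)} + ‖∂_x² u'(t,·)‖_{L²(0,π)} )^{3/5}. (Stability estimate: the H¹-distance of two Burgers solutions at time t is controlled by the L¹-distance of their initial data, via L¹-contraction and interpolation.) -/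
open Real Set MeasureTheory

theorem sq_integral_mul_le {f g : ℝ → ℝ} {a b : ℝ} (hab : a ≤ b)
    (hf : ContinuousOn f (Icc a b)) (hg : ContinuousOn g (Icc a b)) :
    (∫ x in a..b, f x * g x) ^ 2 ≤ (∫ x in a..b, f x ^ 2) * ∫ x in a..b, g x ^ 2 := by
  have key : ∀ c : ℝ, 0 ≤ (∫ x in a..b, g x ^ 2) * (c * c)
      + (2 * ∫ x in a..b, f x * g x) * c + ∫ x in a..b, f x ^ 2 := by
    intro c
    have h1 : IntervalIntegrable (fun x => g x ^ 2) volume a b :=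
      (hg.pow 2).intervalIntegrable_of_Icc hab
    have h2 : IntervalIntegrable (fun x => f x * g x) volume a b :=
      (hf.mul hg).intervalIntegrable_of_Icc hab
    have h3 : IntervalIntegrable (fun x => f x ^ 2) volume a b :=
      (hf.pow 2).intervalIntegrable_of_Icc hab
    have h : ∫ x in a..b, (f x + c * g x) ^ 2 = (∫ x in a..b, g x ^ 2) * (c * c)
        + (2 * ∫ x in a..b, f x * g x) * c + ∫ x in a..b, f x ^ 2 := by
      have e : (fun x => (f x + c * g x) ^ 2)
          = fun x => (c * c) * g x ^ 2 + (2 * c) * (f x * g x) + f x ^ 2 := by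
        ext x; ring
      rw [e, intervalIntegral.integral_add ((h1.const_mul _).add (h2.const_mul _)) h3,
        intervalIntegral.integral_add (h1.const_mul _) (h2.const_mul _),
        intervalIntegral.integral_const_mul, intervalIntegral.integral_const_mul]
      ring
    rw [← h]
    exact intervalIntegral.integral_nonneg hab fun x _ => sq_nonneg _
  have := discrim_le_zero key
  unfold discrim at this
  nlinarith

theorem integral_sub_sq_le {f g : ℝ → ℝ} {a b : ℝ} (hab : a ≤ b)
    (hf : ContinuousOn f (Icc a b)) (hg : ContinuousOn g (Icc a b)) :
    √(∫ x in a..b, (f x - g x) ^ 2) ≤ √(∫ x in a..b, f x ^ 2) + √(∫ x in a..b, g x ^ 2) := by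
  have h1 : IntervalIntegrable (fun x => g x ^ 2) volume a b :=
    (hg.pow 2).intervalIntegrable_of_Icc hab
  have h2 : IntervalIntegrable (fun x => f x * g x) volume a b :=
    (hf.mul hg).intervalIntegrable_of_Icc hab
  have h3 : IntervalIntegrable (fun x => f x ^ 2) volume a b :=
    (hf.pow 2).intervalIntegrable_of_Icc hab
  have e : (fun x => (f x - g x) ^ 2)
      = fun x => f x ^ 2 + (-2) * (f x * g x) + g x ^ 2 := by
    ext x; ring
  rw [e, intervalIntegral.integral_add (h3.add (h2.const_mul _)) h1,
    intervalIntegral.integral_add h3 (h2.const_mul _),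
    intervalIntegral.integral_const_mul]
  have hF : 0 ≤ ∫ x in a..b, f x ^ 2 := intervalIntegral.integral_nonneg hab fun x _ => sq_nonneg _
  have hG : 0 ≤ ∫ x in a..b, g x ^ 2 := intervalIntegral.integral_nonneg hab fun x _ => sq_nonneg _
  have hcs := Real.abs_le_sqrt (sq_integral_mul_le hab hf hg)
  rw [Real.sqrt_mul hF] at hcs
  apply Real.sqrt_le_iff.2 ⟨by positivity, ?_⟩
  nlinarith [Real.sq_sqrt hF, Real.sq_sqrt hG, neg_le_of_abs_le hcs]

/-- Gagliardo–Nirenberg inequality in one dimension, for `C²` functions vanishing at the end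
points. -/
theorem sqrt_integral_deriv_sq_pow_five_le {v v₁ v₂ : ℝ → ℝ} {a b : ℝ} (hab : a ≤ b)
    (hv : ∀ x ∈ Icc a b, HasDerivWithinAt v (v₁ x) (Icc a b) x)
    (hv₁ : ∀ x ∈ Icc a b, HasDerivWithinAt v₁ (v₂ x) (Icc a b) x)
    (hv₂ : ContinuousOn v₂ (Icc a b)) (ha : v a = 0) (hb : v b = 0) :
    √(∫ x in a..b, v₁ x ^ 2) ^ 5 ≤ 2 * (∫ x in a..b, |v x|) ^ 2 * √(∫ x in a..b, v₂ x ^ 2) ^ 3 := by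
  have c : ContinuousOn v (Icc a b) := fun x hx => (hv x hx).continuousWithinAt
  have c₁ : ContinuousOn v₁ (Icc a b) := fun x hx => (hv₁ x hx).continuousWithinAt
  have nn : ∀ g : ℝ → ℝ, 0 ≤ ∫ x in a..b, g x ^ 2 := fun g =>
    intervalIntegral.integral_nonneg hab fun x _ => sq_nonneg _
  have hd : ∀ x ∈ Ioo a b, HasDerivAt v (v₁ x) x := fun x hx =>
    (hv x (Ioo_subset_Icc_self hx)).hasDerivAt (Icc_mem_nhds hx.1 hx.2)
  have hd₁ : ∀ x ∈ Ioo a b, HasDerivAt v₁ (v₂ x) x := fun x hx =>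
    (hv₁ x (Ioo_subset_Icc_self hx)).hasDerivAt (Icc_mem_nhds hx.1 hx.2)
  have hX : ∫ x in a..b, v₁ x ^ 2 ≤ √(∫ x in a..b, v x ^ 2) * √(∫ x in a..b, v₂ x ^ 2) := by
    have i1 : IntervalIntegrable (fun x => v₁ x ^ 2) volume a b :=
      (c₁.pow 2).intervalIntegrable_of_Icc hab
    have i2 : IntervalIntegrable (fun x => v x * v₂ x) volume a b :=
      (c.mul hv₂).intervalIntegrable_of_Icc hab
    have h := intervalIntegral.integral_eq_sub_of_hasDerivAt_of_le hab (c.mul c₁)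
      (fun x hx => (hd x hx).mul (hd₁ x hx))
      (((c₁.mul c₁).add (c.mul hv₂)).intervalIntegrable_of_Icc hab)
    have e : (fun x => v₁ x * v₁ x + v x * v₂ x) = fun x => v₁ x ^ 2 + v x * v₂ x := by
      ext x; ring
    simp only [Pi.mul_apply, ha, hb, zero_mul, sub_zero] at h
    rw [e, intervalIntegral.integral_add i1 i2] at h
    have hcs := Real.abs_le_sqrt (sq_integral_mul_le hab c hv₂)
    rw [Real.sqrt_mul (nn v)] at hcs
    linarith [neg_le_of_abs_le hcs]
  have hS : ∀ x ∈ Icc a b, v x ^ 2 ≤ 2 * (√(∫ x in a..b, v x ^ 2) * √(∫ x in a..b, v₁ x ^ 2)) := by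
    intro y hy
    have sub : Icc a y ⊆ Icc a b := Icc_subset_Icc_right hy.2
    have h := intervalIntegral.integral_eq_sub_of_hasDerivAt_of_le hy.1 ((c.mul c).mono sub)
      (fun x hx => (hd x ⟨hx.1, hx.2.trans_le hy.2⟩).mul (hd x ⟨hx.1, hx.2.trans_le hy.2⟩))
      ((((c₁.mul c).add (c.mul c₁)).mono sub).intervalIntegrable_of_Icc hy.1)
    simp only [Pi.mul_apply, ha, zero_mul, sub_zero] at h
    have e : (fun x => v₁ x * v x + v x * v₁ x) = fun x => 2 * (v x * v₁ x) := by
      ext x; ring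
    rw [e, intervalIntegral.integral_const_mul] at h
    have hle : ∫ x in a..y, v x * v₁ x ≤ ∫ x in a..b, |v x| * |v₁ x| := by
      calc ∫ x in a..y, v x * v₁ x ≤ ∫ x in a..y, |v x| * |v₁ x| :=
            intervalIntegral.integral_mono_on hy.1
              (((c.mul c₁).mono sub).intervalIntegrable_of_Icc hy.1)
              (((c.abs.mul c₁.abs).mono sub).intervalIntegrable_of_Icc hy.1)
              fun x _ => by rw [← abs_mul]; exact le_abs_self _
        _ ≤ _ := intervalIntegral.integral_mono_interval le_rfl hy.1 hy.2
              (Filter.Eventually.of_forall fun x => by positivity)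
              ((c.abs.mul c₁.abs).intervalIntegrable_of_Icc hab)
    have hcs := Real.abs_le_sqrt (sq_integral_mul_le hab c.abs c₁.abs)
    simp only [sq_abs] at hcs
    rw [Real.sqrt_mul (nn v)] at hcs
    nlinarith [le_of_abs_le hcs]
  set A := ∫ x in a..b, |v x| with hA
  have hA0 : 0 ≤ A := intervalIntegral.integral_nonneg hab fun x _ => abs_nonneg _
  set Y := √(∫ x in a..b, v x ^ 2)
  set X := √(∫ x in a..b, v₁ x ^ 2)
  set B := √(∫ x in a..b, v₂ x ^ 2)
  have hY2 : Y ^ 2 = ∫ x in a..b, v x ^ 2 := Real.sq_sqrt (nn v)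
  have hX2 : X ^ 2 = ∫ x in a..b, v₁ x ^ 2 := Real.sq_sqrt (nn v₁)
  have hX0 : 0 ≤ X := Real.sqrt_nonneg _
  have hY0 : 0 ≤ Y := Real.sqrt_nonneg _
  have hB0 : 0 ≤ B := Real.sqrt_nonneg _
  rw [← hX2] at hX
  have hYA : Y ^ 2 ≤ √(2 * (Y * X)) * A := by
    rw [hY2, hA, ← intervalIntegral.integral_const_mul]
    refine intervalIntegral.integral_mono_on hab ((c.pow 2).intervalIntegrable_of_Icc hab)
      ((c.abs.intervalIntegrable_of_Icc hab).const_mul _) fun x hx => ?_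
    rw [← sq_abs, sq]
    exact mul_le_mul_of_nonneg_right (Real.abs_le_sqrt (hS x hx)) (abs_nonneg _)
  have hY4 : Y ^ 4 ≤ 2 * (Y * X) * A ^ 2 := by
    calc Y ^ 4 = (Y ^ 2) ^ 2 := by ring
      _ ≤ (√(2 * (Y * X)) * A) ^ 2 := by gcongr
      _ = _ := by rw [mul_pow, Real.sq_sqrt (by positivity)]
  have hY3 : Y ^ 3 ≤ 2 * X * A ^ 2 := by
    rcases hY0.eq_or_lt with h | h
    · rw [← h]; simp; positivity
    · exact le_of_mul_le_mul_left (by linarith) h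
  have hX6 : X ^ 6 ≤ X * (2 * A ^ 2 * B ^ 3) := by
    calc X ^ 6 = (X ^ 2) ^ 3 := by ring
      _ ≤ (Y * B) ^ 3 := by gcongr
      _ = Y ^ 3 * B ^ 3 := by ring
      _ ≤ (2 * X * A ^ 2) * B ^ 3 := by gcongr
      _ = _ := by ring
  rcases hX0.eq_or_lt with h | h
  · rw [← h]; simp; positivity
  · exact le_of_mul_le_mul_left (by linarith) h

theorem integral_le_add_of_integral_deriv_le {g g' : ℝ → ℝ → ℝ} {T a b K t : ℝ} (hab : a ≤ b)
    (ht : t ∈ Icc 0 T)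
    (hg : ContinuousOn (fun p : ℝ × ℝ => g p.1 p.2) (Icc 0 T ×ˢ Icc a b))
    (hg' : ContinuousOn (fun p : ℝ × ℝ => g' p.1 p.2) (Icc 0 T ×ˢ Icc a b))
    (hd : ∀ s ∈ Icc 0 T, ∀ x ∈ Icc a b,
      HasDerivWithinAt (fun τ => g τ x) (g' s x) (Icc 0 T) s)
    (hK : ∀ s ∈ Ioo 0 T, ∫ x in a..b, g' s x ≤ K) :
    ∫ x in a..b, g t x ≤ (∫ x in a..b, g 0 x) + t * K := by
  have hT : 0 ≤ T := ht.1.trans ht.2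
  set F : ℝ → ℝ → ℝ := fun s x => g' (projIcc 0 T hT s) (projIcc a b hab x)
  have hF : Continuous (Function.uncurry F) := by
    have : Continuous fun p : ℝ × ℝ =>
        ((projIcc 0 T hT p.1 : ℝ), (projIcc a b hab p.2 : ℝ)) :=
      (continuous_subtype_val.comp (continuous_projIcc.comp continuous_fst)).prodMk
        (continuous_subtype_val.comp (continuous_projIcc.comp continuous_snd))
    exact hg'.comp_continuous this fun p => ⟨(projIcc 0 T hT p.1).2, (projIcc a b hab p.2).2⟩
  have hFeq : ∀ s ∈ Icc 0 T, ∀ x ∈ Icc a b, F s x = g' s x := fun s hs x hx => by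
    simp only [F, projIcc_of_mem hT hs, projIcc_of_mem hab hx]
  have slice : ∀ s ∈ Icc 0 T, IntervalIntegrable (g s) volume a b := fun s hs =>
    ContinuousOn.intervalIntegrable_of_Icc hab
      (hg.comp (by fun_prop : Continuous fun x : ℝ => (s, x)).continuousOn fun x hx => ⟨hs, hx⟩)
  have h0 : (0 : ℝ) ∈ Icc 0 T := ⟨le_rfl, hT⟩
  have ftc : ∀ x ∈ Icc a b, g t x - g 0 x = ∫ s in (0 : ℝ)..t, F s x := by
    intro x hx
    refine (intervalIntegral.integral_eq_sub_of_hasDerivAt_of_le (f := fun τ => g τ x) ht.1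
      (fun s hs => ((hd s ⟨hs.1, hs.2.trans ht.2⟩ x hx).continuousWithinAt).mono
        (Icc_subset_Icc_right ht.2)) (fun s hs => ?_) ?_).symm
    · have hs' : s ∈ Icc 0 T := ⟨hs.1.le, hs.2.le.trans ht.2⟩
      rw [hFeq s hs' x hx]
      exact (hd s hs' x hx).hasDerivAt (Icc_mem_nhds hs.1 (hs.2.trans_le ht.2))
    · exact (hF.comp (by fun_prop : Continuous fun s : ℝ => (s, x))).intervalIntegrable _ _
  have key : (∫ x in a..b, g t x) - ∫ x in a..b, g 0 x
      = ∫ s in (0 : ℝ)..t, ∫ x in a..b, F s x := by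
    rw [← intervalIntegral.integral_sub (slice t ht) (slice 0 h0),
      intervalIntegral_intervalIntegral_swap]
    · refine intervalIntegral.integral_congr fun x hx => ftc x ?_
      rwa [uIcc_of_le hab] at hx
    · have hc : IsCompact (uIcc 0 t ×ˢ uIcc a b) := isCompact_uIcc.prod isCompact_uIcc
      exact (hF.continuousOn.integrableOn_compact hc).mono_set
        (prod_mono uIoc_subset_uIcc uIoc_subset_uIcc)
  have hle : ∫ s in (0 : ℝ)..t, ∫ x in a..b, F s x ≤ ∫ _s in (0 : ℝ)..t, K := by
    refine intervalIntegral.integral_mono_on_of_le_Ioo ht.1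
      ((intervalIntegral.continuous_parametric_intervalIntegral_of_continuous' hF
        a b).intervalIntegrable _ _) intervalIntegrable_const fun s hs => ?_
    have hs' : s ∈ Ioo 0 T := ⟨hs.1, hs.2.trans_le ht.2⟩
    refine le_of_eq_of_le (intervalIntegral.integral_congr fun x hx => ?_) (hK s hs')
    rw [uIcc_of_le hab] at hx
    exact hFeq s (Ioo_subset_Icc_self hs') x hx
  rw [intervalIntegral.integral_const, sub_zero, smul_eq_mul] at hle
  linarith

theorem hasDerivWithinAt_sqrt_sq_add {v : ℝ → ℝ} {v' δ x : ℝ} {s : Set ℝ} (hδ : 0 < δ)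
    (hv : HasDerivWithinAt v v' s x) :
    HasDerivWithinAt (fun y => √(v y ^ 2 + δ ^ 2)) (v x / √(v x ^ 2 + δ ^ 2) * v') s x := by
  have hp : 0 < v x ^ 2 + δ ^ 2 := by positivity
  refine (((hv.pow 2).add_const (δ ^ 2)).sqrt hp.ne').congr_deriv ?_
  simp only [Pi.pow_apply, Nat.cast_ofNat, Nat.add_one_sub_one, pow_one]
  field_simp

theorem hasDerivAt_div_sqrt_sq_add {v : ℝ → ℝ} {v' δ x : ℝ} (hδ : 0 < δ)
    (hv : HasDerivAt v v' x) :
    HasDerivAt (fun y => v y / √(v y ^ 2 + δ ^ 2))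
      (δ ^ 2 / √(v x ^ 2 + δ ^ 2) ^ 3 * v') x := by
  have hr : 0 < √(v x ^ 2 + δ ^ 2) := by positivity
  have h2 : √(v x ^ 2 + δ ^ 2) ^ 2 = v x ^ 2 + δ ^ 2 := Real.sq_sqrt (by positivity)
  have h := hv.div ((hasDerivWithinAt_univ.1
    (hasDerivWithinAt_sqrt_sq_add hδ hv.hasDerivWithinAt))) hr.ne'
  refine h.congr_deriv ?_
  set r := √(v x ^ 2 + δ ^ 2)
  have hδ2 : δ ^ 2 = r ^ 2 - v x ^ 2 := by linarith
  rw [hδ2]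
  field_simp

/-- Testing a viscous conservation law with the regularised sign of the solution: the viscous
term absorbs the flux up to an error that vanishes with the regularisation. -/
theorem integral_sign_approx_mul_le {v v₁ v₂ p p₁ : ℝ → ℝ} {a b ν δ M : ℝ} (hab : a ≤ b)
    (hν : 0 < ν) (hδ : 0 < δ)
    (hv : ∀ x ∈ Icc a b, HasDerivWithinAt v (v₁ x) (Icc a b) x)
    (hv₁ : ∀ x ∈ Icc a b, HasDerivWithinAt v₁ (v₂ x) (Icc a b) x)
    (hp : ∀ x ∈ Icc a b, HasDerivWithinAt p (p₁ x) (Icc a b) x)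
    (hv₂ : ContinuousOn v₂ (Icc a b)) (hp₁ : ContinuousOn p₁ (Icc a b))
    (hM : ∀ x ∈ Icc a b, |p x| ≤ M) (ha : v a = 0) (hb : v b = 0) :
    ∫ x in a..b, v x / √(v x ^ 2 + δ ^ 2) * (ν * v₂ x - (p₁ x * v x + p x * v₁ x))
      ≤ (b - a) * (δ * (M ^ 2 / (4 * ν))) := by
  have c : ContinuousOn v (Icc a b) := fun x hx => (hv x hx).continuousWithinAt
  have c₁ : ContinuousOn v₁ (Icc a b) := fun x hx => (hv₁ x hx).continuousWithinAt
  have cp : ContinuousOn p (Icc a b) := fun x hx => (hp x hx).continuousWithinAt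
  have hr : ∀ x, 0 < √(v x ^ 2 + δ ^ 2) := fun x => by positivity
  have cr : ContinuousOn (fun x => √(v x ^ 2 + δ ^ 2)) (Icc a b) := by fun_prop
  have cq : ContinuousOn (fun x => v x / √(v x ^ 2 + δ ^ 2)) (Icc a b) :=
    c.div cr fun x _ => (hr x).ne'
  have cq' : ContinuousOn (fun x => δ ^ 2 / √(v x ^ 2 + δ ^ 2) ^ 3 * v₁ x) (Icc a b) :=
    (continuousOn_const.div (cr.pow 3) fun x _ => (pow_pos (hr x) 3).ne').mul c₁
  have cG' : ContinuousOn (fun x => δ ^ 2 / √(v x ^ 2 + δ ^ 2) ^ 3 * v₁ x * (ν * v₁ x - p x * v x)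
      + v x / √(v x ^ 2 + δ ^ 2) * (ν * v₂ x - (p₁ x * v x + p x * v₁ x))) (Icc a b) :=
    (cq'.mul (by fun_prop)).add (cq.mul (by fun_prop))
  have hG := intervalIntegral.integral_eq_sub_of_hasDerivAt_of_le
    (f := fun x => v x / √(v x ^ 2 + δ ^ 2) * (ν * v₁ x - p x * v x)) hab
    (cq.mul (by fun_prop)) (fun x hx => by
      have hn := Icc_mem_nhds hx.1 hx.2
      have hx' := Ioo_subset_Icc_self hx
      have d := (hv x hx').hasDerivAt hn
      exact (hasDerivAt_div_sqrt_sq_add hδ d).mul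
        ((((hv₁ x hx').hasDerivAt hn).const_mul ν).sub (((hp x hx').hasDerivAt hn).mul d)))
    (cG'.intervalIntegrable_of_Icc hab)
  simp only [ha, hb, zero_div, zero_mul, sub_zero] at hG
  have hle := intervalIntegral.integral_mono_on (μ := volume) hab
    ((cq.mul (by fun_prop : ContinuousOn (fun x => ν * v₂ x - (p₁ x * v x + p x * v₁ x))
      (Icc a b))).intervalIntegrable_of_Icc hab)
    ((cG'.intervalIntegrable_of_Icc hab).add
      (intervalIntegrable_const (c := δ * (M ^ 2 / (4 * ν))))) fun x hx => ?_
  · rw [intervalIntegral.integral_add (cG'.intervalIntegrable_of_Icc hab) intervalIntegrable_const,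
      hG, intervalIntegral.integral_const, zero_add, smul_eq_mul] at hle
    exact hle
  · simp only [Pi.mul_apply]
    have hr0 := hr x
    have h2 : √(v x ^ 2 + δ ^ 2) ^ 2 = v x ^ 2 + δ ^ 2 := Real.sq_sqrt (by positivity)
    set r := √(v x ^ 2 + δ ^ 2)
    have hδr : δ ≤ r := Real.le_sqrt_of_sq_le (by nlinarith [sq_nonneg (v x)])
    have hvr : v x ^ 2 ≤ r ^ 2 := by nlinarith [sq_nonneg δ]
    have hpM : p x ^ 2 ≤ M ^ 2 := by
      rw [← sq_abs]; exact pow_le_pow_left₀ (abs_nonneg _) (hM x hx) 2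
    have hw : δ ^ 2 / r ^ 3 * v x ^ 2 ≤ δ := by
      rw [div_mul_eq_mul_div, div_le_iff₀ (by positivity)]
      calc δ ^ 2 * v x ^ 2 ≤ (δ * r) * r ^ 2 := by gcongr; nlinarith
        _ = δ * r ^ 3 := by ring
    have hy : -(M ^ 2 / (4 * ν) * v x ^ 2) ≤ v₁ x * (ν * v₁ x - p x * v x) := by
      have h3 : v₁ x * (ν * v₁ x - p x * v x)
          = (2 * ν * v₁ x - p x * v x) ^ 2 / (4 * ν) - p x ^ 2 / (4 * ν) * v x ^ 2 := by
        field_simp; ring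
      have h4 : p x ^ 2 / (4 * ν) * v x ^ 2 ≤ M ^ 2 / (4 * ν) * v x ^ 2 := by gcongr
      have h5 : 0 ≤ (2 * ν * v₁ x - p x * v x) ^ 2 / (4 * ν) := by positivity
      linarith
    have h6 := mul_le_mul_of_nonneg_left hy (show 0 ≤ δ ^ 2 / r ^ 3 by positivity)
    have h7 := mul_le_mul_of_nonneg_right hw (show 0 ≤ M ^ 2 / (4 * ν) by positivity)
    linarith

/-- `L¹`-contraction for two solutions of the Burgers equation with the same forcing. -/
theorem BurgersSolution.integral_abs_sub_le {ν T : ℝ} (hν : 0 < ν) {f : ℝ → ℝ → ℝ}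
    {u ut ux uxx u' u't u'x u'xx : ℝ → ℝ → ℝ} (h : BurgersSolution ν T f u ut ux uxx)
    (h' : BurgersSolution ν T f u' u't u'x u'xx) {t : ℝ} (ht : t ∈ Icc 0 T) :
    ∫ x in (0:ℝ)..π, |u t x - u' t x| ≤ ∫ x in (0:ℝ)..π, |u 0 x - u' 0 x| := by
  have hπ := Real.pi_pos.le
  have slice : ∀ {g : ℝ → ℝ → ℝ},
      ContinuousOn (fun p : ℝ × ℝ => g p.1 p.2) (Icc 0 T ×ˢ Icc 0 π) →
      ∀ s ∈ Icc 0 T, ContinuousOn (g s) (Icc 0 π) := fun hg s hs =>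
    hg.comp (by fun_prop : Continuous fun x : ℝ => (s, x)).continuousOn fun x hx => ⟨hs, hx⟩
  obtain ⟨M, hM⟩ := (isCompact_Icc.prod isCompact_Icc).exists_bound_of_continuousOn
    ((h.cont.add h'.cont).div_const 2)
  have h0 : (0 : ℝ) ∈ Icc 0 T := ⟨le_rfl, ht.1.trans ht.2⟩
  set L := t * (π * (M ^ 2 / (4 * ν))) + π with hL
  have hL0 : 0 ≤ L := by have := ht.1; positivity
  have cv := h.cont.sub h'.cont
  have sv := slice (g := fun s x => u s x - u' s x) cv
  have reg : ∀ δ > 0, ∫ x in (0:ℝ)..π, |u t x - u' t x|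
      ≤ (∫ x in (0:ℝ)..π, |u 0 x - u' 0 x|) + δ * L := by
    intro δ hδ
    have cr : ContinuousOn (fun p : ℝ × ℝ => √((u p.1 p.2 - u' p.1 p.2) ^ 2 + δ ^ 2))
        (Icc 0 T ×ˢ Icc 0 π) := by
      exact ((cv.pow 2).add continuousOn_const).sqrt
    have sr := slice (g := fun s x => √((u s x - u' s x) ^ 2 + δ ^ 2)) cr
    have main := integral_le_add_of_integral_deriv_le
      (g := fun s x => √((u s x - u' s x) ^ 2 + δ ^ 2))
      (g' := fun s x => (u s x - u' s x) / √((u s x - u' s x) ^ 2 + δ ^ 2) * (ut s x - u't s x))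
      (K := (π - 0) * (δ * (M ^ 2 / (4 * ν)))) hπ ht cr
      ((cv.div cr fun p _ => by positivity).mul (h.cont_t.sub h'.cont_t))
      (fun s hs x hx => hasDerivWithinAt_sqrt_sq_add hδ
        ((h.hasDeriv_t s hs x hx).sub (h'.hasDeriv_t s hs x hx)))
      (fun s hs => by
        have hs' := Ioo_subset_Icc_self hs
        refine le_of_eq_of_le ?_ (integral_sign_approx_mul_le (M := M) hπ hν hδ
          (v := fun x => u s x - u' s x) (p := fun x => (u s x + u' s x) / 2)
          (fun x hx => (h.hasDeriv_x s hs' x hx).sub (h'.hasDeriv_x s hs' x hx))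
          (fun x hx => (h.hasDeriv_xx s hs' x hx).sub (h'.hasDeriv_xx s hs' x hx))
          (fun x hx => ((h.hasDeriv_x s hs' x hx).add (h'.hasDeriv_x s hs' x hx)).div_const 2)
          ((slice h.cont_xx s hs').sub (slice h'.cont_xx s hs'))
          (((slice h.cont_x s hs').add (slice h'.cont_x s hs')).div_const 2)
          (fun x hx => hM (s, x) ⟨hs', hx⟩)
          (by simp [h.bc0 s hs', h'.bc0 s hs']) (by simp [h.bcπ s hs', h'.bcπ s hs']))
        rw [intervalIntegral.integral_of_le hπ, intervalIntegral.integral_of_le hπ,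
          integral_Ioc_eq_integral_Ioo, integral_Ioc_eq_integral_Ioo]
        refine setIntegral_congr_fun measurableSet_Ioo fun x hx => ?_
        have e := h.eqn s hs x hx
        have e' := h'.eqn s hs x hx
        have : ut s x - u't s x = ν * (uxx s x - u'xx s x)
            - ((ux s x + u'x s x) / 2 * (u s x - u' s x)
              + (u s x + u' s x) / 2 * (ux s x - u'x s x)) := by linarith
        simp only [this])
    have lower : ∫ x in (0:ℝ)..π, |u t x - u' t x|
        ≤ ∫ x in (0:ℝ)..π, √((u t x - u' t x) ^ 2 + δ ^ 2) :=
      intervalIntegral.integral_mono_on hπ ((sv t ht).abs.intervalIntegrable_of_Icc hπ)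
        ((sr t ht).intervalIntegrable_of_Icc hπ)
        fun x _ => Real.abs_le_sqrt (by nlinarith [sq_nonneg δ])
    have upper : ∫ x in (0:ℝ)..π, √((u 0 x - u' 0 x) ^ 2 + δ ^ 2)
        ≤ ∫ x in (0:ℝ)..π, (|u 0 x - u' 0 x| + δ) :=
      intervalIntegral.integral_mono_on hπ ((sr 0 h0).intervalIntegrable_of_Icc hπ)
        (((sv 0 h0).abs.add continuousOn_const).intervalIntegrable_of_Icc hπ)
        fun x _ => Real.sqrt_le_iff.2 ⟨by positivity, by
          nlinarith [sq_abs (u 0 x - u' 0 x), mul_nonneg (abs_nonneg (u 0 x - u' 0 x)) hδ.le]⟩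
    rw [intervalIntegral.integral_add ((sv 0 h0).abs.intervalIntegrable_of_Icc hπ)
      intervalIntegrable_const, intervalIntegral.integral_const, smul_eq_mul] at upper
    rw [hL]
    linarith
  refine le_of_forall_pos_le_add fun ε hε => (reg (ε / (L + 1)) (by positivity)).trans ?_
  gcongr
  rw [div_mul_eq_mul_div, div_le_iff₀ (by positivity)]
  nlinarith

/-- Stability estimate: the `H¹`-distance between two Burgers solutions at time
`t` is controlled by the `L¹`-distance of their initial data together with the
`L²`-norms of their second spatial derivatives at time `t`, with a universal
constant `C` (independent of `ν`, `T`, `f` and the solutions). -/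
theorem burgers_H1_stability :
    ∃ C > (0:ℝ),
      ∀ (ν T : ℝ), 0 < ν → 0 < T →
      ∀ (f : ℝ → ℝ → ℝ),
        ContinuousOn (fun p : ℝ × ℝ => f p.1 p.2) (Icc 0 T ×ˢ Icc 0 π) →
      ∀ (u ut ux uxx u' u't u'x u'xx : ℝ → ℝ → ℝ),
        BurgersSolution ν T f u ut ux uxx →
        BurgersSolution ν T f u' u't u'x u'xx →
      ∀ t ∈ Icc (0:ℝ) T,
        (∫ x in (0:ℝ)..π, |ux t x - u'x t x| ^ 2) ^ ((1:ℝ)/2) ≤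
          C * (∫ x in (0:ℝ)..π, |u 0 x - u' 0 x|) ^ ((2:ℝ)/5)
            * ((∫ x in (0:ℝ)..π, (uxx t x) ^ 2) ^ ((1:ℝ)/2)
               + (∫ x in (0:ℝ)..π, (u'xx t x) ^ 2) ^ ((1:ℝ)/2)) ^ ((3:ℝ)/5) := by
  refine ⟨2, two_pos, fun ν T hν _ f _ u ut ux uxx u' u't u'x u'xx h h' t ht => ?_⟩
  have hπ := Real.pi_pos.le
  have slice : ∀ {g : ℝ → ℝ → ℝ},
      ContinuousOn (fun p : ℝ × ℝ => g p.1 p.2) (Icc 0 T ×ˢ Icc 0 π) →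
      ContinuousOn (g t) (Icc 0 π) := fun hg =>
    hg.comp (by fun_prop : Continuous fun x : ℝ => (t, x)).continuousOn fun x hx => ⟨ht, hx⟩
  have contraction := h.integral_abs_sub_le hν h' ht
  have minkowski := integral_sub_sq_le hπ (slice h.cont_xx) (slice h'.cont_xx)
  have interpolation := sqrt_integral_deriv_sq_pow_five_le hπ
    (v := fun x => u t x - u' t x)
    (fun x hx => (h.hasDeriv_x t ht x hx).sub (h'.hasDeriv_x t ht x hx))
    (fun x hx => (h.hasDeriv_xx t ht x hx).sub (h'.hasDeriv_xx t ht x hx))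
    ((slice h.cont_xx).sub (slice h'.cont_xx))
    (by simp [h.bc0 t ht, h'.bc0 t ht]) (by simp [h.bcπ t ht, h'.bcπ t ht])
  simp only [sq_abs, ← Real.sqrt_eq_rpow]
  have hA : 0 ≤ ∫ x in (0:ℝ)..π, |u t x - u' t x| :=
    intervalIntegral.integral_nonneg hπ fun x _ => abs_nonneg _
  have hA0 := hA.trans contraction
  set A₀ := ∫ x in (0:ℝ)..π, |u 0 x - u' 0 x|
  set B := √(∫ x in (0:ℝ)..π, uxx t x ^ 2) + √(∫ x in (0:ℝ)..π, u'xx t x ^ 2)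
  have hB : 0 ≤ B := by positivity
  refine le_of_pow_le_pow_left₀ (n := 5) (by norm_num) (by positivity) (interpolation.trans ?_)
  rw [mul_pow, mul_pow, ← Real.rpow_mul_natCast hA0, ← Real.rpow_mul_natCast hB,
    show (2:ℝ) / 5 * (5 : ℕ) = (2 : ℕ) by norm_num, show (3:ℝ) / 5 * (5 : ℕ) = (3 : ℕ) by norm_num,
    Real.rpow_natCast, Real.rpow_natCast]
  gcongr
  norm_num
end
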